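/- arXiv:2504.08938 — 4 statements merged into one kernel-verified Lean document; each statement's English description precedes it below -/
import Mathlib

section
/- For every subset S ⊆ W with exactly three elements and every environment ω ∈ Ω, the third-order environment derivative of the first-passage percolation time satisfies ∂_S f(ω) ≤ b−a. -/
noncomputable section

/-! ### First-passage percolation model

Vertices are points of `ℤ^d`; two vertices are adjacent when their ℓ¹-distance is `1`.
For `n : ℕ`, the graph is restricted to the box `[-2n, 2n]^d`; `EdgeSet d n` is its edge
set `W_n`, and an environment `ω ∈ Ω_n = {a,b}^{W_n}` is modelled as a function
`Sym2 (Vtx d) → ℝ` whose values on `W_n` lie in `{a, b}` (`ValidEnv`).  `fppT d v n ω`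
is the minimal passage time from the source `0` to the sink `n • v`. -/

abbrev Vtx (d : ℕ) : Type := Fin d → ℤ

/-- Two lattice points are adjacent when their ℓ¹ distance equals 1. -/
def adjV {d : ℕ} (x y : Vtx d) : Prop := (∑ i, |x i - y i|) = 1

/-- A vertex lies in the box `[-2n, 2n]^d`. -/
def inBox {d : ℕ} (n : ℕ) (x : Vtx d) : Prop := ∀ i, |x i| ≤ (2 * n : ℤ)

/-- The edge set `W_n`: nearest-neighbour pairs inside the box. -/
def EdgeSet (d n : ℕ) : Set (Sym2 (Vtx d)) :=
  {e | ∃ x y : Vtx d, e = s(x, y) ∧ adjV x y ∧ inBox n x ∧ inBox n y}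

/-- `p` is a path from `u` to `w` inside the box `[-2n, 2n]^d`. -/
def IsPath {d : ℕ} (n : ℕ) (u w : Vtx d) (p : List (Vtx d)) : Prop :=
  p.Chain' adjV ∧ p.head? = some u ∧ p.getLast? = some w ∧ ∀ x ∈ p, inBox n x

/-- The passage time `T(p, ω)`: the sum of `ω_e` over the edges of `p`. -/
def pathTime {d : ℕ} (ω : Sym2 (Vtx d) → ℝ) (p : List (Vtx d)) : ℝ :=
  ((p.zip p.tail).map fun q => ω s(q.1, q.2)).sum

/-- The first-passage time `f_n(ω)`: minimal passage time from `0` to `n • v`. -/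
def fppT (d : ℕ) (v : Vtx d) (n : ℕ) (ω : Sym2 (Vtx d) → ℝ) : ℝ :=
  sInf {t : ℝ | ∃ p : List (Vtx d), IsPath n 0 (fun i => (n : ℤ) * v i) p ∧ t = pathTime ω p}

/-- A geodesic: a path from `0` to `n • v` attaining the minimal passage time. -/
def IsGeodesic (d : ℕ) (v : Vtx d) (n : ℕ) (ω : Sym2 (Vtx d) → ℝ) (p : List (Vtx d)) : Prop :=
  IsPath n 0 (fun i => (n : ℤ) * v i) p ∧ pathTime ω p = fppT d v n ω

/-- The list of edges traversed by a path. -/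
def edgesOf {d : ℕ} (p : List (Vtx d)) : List (Sym2 (Vtx d)) :=
  (p.zip p.tail).map fun q => s(q.1, q.2)

/-- First-order environment derivative `∂_j φ = φ∘σ_j^b − φ∘σ_j^a`, where `σ_j^δ` sets
coordinate `j` to `δ`. -/
def envDeriv {E : Type*} [DecidableEq E] (a b : ℝ) (j : E) (φ : (E → ℝ) → ℝ) : (E → ℝ) → ℝ :=
  fun ω => φ (Function.update ω j b) - φ (Function.update ω j a)

/-- Higher-order environment derivative `∂_S φ`, obtained by iterating the first-order
derivative over the elements of `S` (the recursion `∂_S φ = ∂_{S∖{j}}(∂_j φ)`; the result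
is independent of the order). -/
def envDerivOn {E : Type*} [DecidableEq E] (a b : ℝ) (S : Finset E) (φ : (E → ℝ) → ℝ) :
    (E → ℝ) → ℝ :=
  S.toList.foldr (fun j ψ => envDeriv a b j ψ) φ

/-- `ω ∈ Ω_n = {a,b}^{W_n}`: the environment takes only the values `a`, `b` on `W_n`. -/
def ValidEnv (d n : ℕ) (a b : ℝ) (ω : Sym2 (Vtx d) → ℝ) : Prop :=
  ∀ e ∈ EdgeSet d n, ω e = a ∨ ω e = b

/-- The box graph. -/
def boxG (d n : ℕ) : SimpleGraph (Vtx d) where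
  Adj x y := adjV x y ∧ inBox n x ∧ inBox n y
  symm := ⟨fun x y h => ⟨by
    have h1 := h.1
    unfold adjV at *
    rw [← h1]
    exact Finset.sum_congr rfl fun i _ => abs_sub_comm _ _, h.2.2, h.2.1⟩⟩
  loopless := ⟨fun x h => by
    have h1 := h.1
    simp [adjV] at h1⟩

def tmL {E : Type*} (ω : E → ℝ) (L : List E) : ℝ := (L.map ω).sum

theorem tmL_update {E : Type*} [DecidableEq E] (ω : E → ℝ) (e1 e2 e3 : E)
    (h12 : e1 ≠ e2) (h13 : e1 ≠ e3) (h23 : e2 ≠ e3) (x y z : ℝ) (L : List E) :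
    tmL (Function.update (Function.update (Function.update ω e1 x) e2 y) e3 z) L =
    tmL (Function.update (Function.update (Function.update ω e1 0) e2 0) e3 0) L
      + L.count e1 * x + L.count e2 * y + L.count e3 * z := by
  induction L with
  | nil => simp [tmL]
  | cons e L ih =>
    simp only [tmL, List.map_cons, List.sum_cons] at ih ⊢
    rw [ih]
    by_cases c3 : e = e3
    · subst c3
      simp [List.count_cons, h13.symm, h23.symm]
      ring
    · by_cases c2 : e = e2
      · subst c2
        simp [List.count_cons, h12.symm, h23]
        ring
      · by_cases c1 : e = e1
        · subst c1
          simp [List.count_cons, h12, h13]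
          ring
        · simp [List.count_cons, Function.update_of_ne, c1, c2, c3]
          ring

theorem walk_support_chain {d n : ℕ} {u w : Vtx d} (W : (boxG d n).Walk u w) :
    W.support.IsChain adjV := by
  have h := W.isChain_adj_support
  exact h.imp fun _ _ h => h.1

theorem walk_pathTime {d n : ℕ} {u w : Vtx d} (ω : Sym2 (Vtx d) → ℝ)
    (W : (boxG d n).Walk u w) : pathTime ω W.support = tmL ω W.edges := by
  induction W with
  | nil => simp [pathTime, tmL]
  | cons h p ih =>
    rw [SimpleGraph.Walk.edges_cons, SimpleGraph.Walk.support_cons]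
    simp only [tmL, List.map_cons, List.sum_cons] at ih ⊢
    rw [← ih]
    cases p <;> simp [pathTime]

theorem walk_isPath {d n : ℕ} {u w : Vtx d} (hu : inBox n u)
    (W : (boxG d n).Walk u w) : IsPath n u w W.support := by
  refine ⟨walk_support_chain W, ?_, ?_, ?_⟩
  · cases W <;> simp
  · rw [List.getLast?_eq_getLast_of_ne_nil W.support_ne_nil, SimpleGraph.Walk.getLast_support]
  · induction W with
    | nil => simpa using hu
    | cons h p ih =>
      intro x hx
      rw [SimpleGraph.Walk.support_cons, List.mem_cons] at hx
      rcases hx with rfl | hx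
      · exact hu
      · exact ih h.2.2 x hx

theorem isPath_walk {d n : ℕ} {w : Vtx d} (p : List (Vtx d)) :
    ∀ u, IsPath n u w p → ∃ W : (boxG d n).Walk u w, W.support = p := by
  induction p with
  | nil => intro u h; simp [IsPath] at h
  | cons x p ih =>
    rintro u ⟨h1, h2, h3, h4⟩
    simp at h2
    subst h2
    cases p with
    | nil =>
      simp at h3
      subst h3
      exact ⟨SimpleGraph.Walk.nil, rfl⟩
    | cons y p =>
      have h1' := List.isChain_cons_cons.1 h1
      obtain ⟨W, hW⟩ := ih y ⟨h1'.2, by simp, by simpa using h3,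
        fun z hz => h4 z (List.mem_cons_of_mem _ hz)⟩
      refine ⟨SimpleGraph.Walk.cons (show (boxG d n).Adj x y from
        ⟨h1'.1, h4 x (by simp), h4 y (by simp)⟩) W, ?_⟩
      simp [hW]

theorem inBox_zero (d n : ℕ) : inBox n (0 : Vtx d) := by
  intro i; simp

theorem fppT_eq {d n : ℕ} (v : Vtx d) (ω : Sym2 (Vtx d) → ℝ) :
    fppT d v n ω = sInf (Set.range fun W : (boxG d n).Walk 0 (fun i => (n : ℤ) * v i) =>
      tmL ω W.edges) := by
  unfold fppT
  congr 1
  ext t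
  constructor
  · rintro ⟨p, hp, rfl⟩
    obtain ⟨W, rfl⟩ := isPath_walk p _ hp
    exact ⟨W, (walk_pathTime ω W).symm⟩
  · rintro ⟨W, rfl⟩
    exact ⟨W.support, walk_isPath (inBox_zero d n) W, (walk_pathTime ω W).symm⟩

theorem edge_mem {d n : ℕ} {e : Sym2 (Vtx d)} (h : e ∈ (boxG d n).edgeSet) :
    e ∈ EdgeSet d n := by
  induction e with
  | _ x y => exact ⟨x, y, rfl, h.1, h.2.1, h.2.2⟩

theorem tmL_nonneg {d n : ℕ} {a b : ℝ} (ha : 0 < a) (hab : a < b) {ω : Sym2 (Vtx d) → ℝ}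
    (hω : ValidEnv d n a b ω) {u w : Vtx d} (W : (boxG d n).Walk u w) :
    0 ≤ tmL ω W.edges := by
  apply List.sum_nonneg
  intro t ht
  obtain ⟨e, he, rfl⟩ := List.mem_map.1 ht
  rcases hω e (edge_mem (W.edges_subset_edgeSet he)) with h | h <;> rw [h] <;> linarith

theorem fppT_le {d n : ℕ} {a b : ℝ} (ha : 0 < a) (hab : a < b) {ω : Sym2 (Vtx d) → ℝ}
    (hω : ValidEnv d n a b ω) (v : Vtx d)
    (W : (boxG d n).Walk 0 (fun i => (n : ℤ) * v i)) :
    fppT d v n ω ≤ tmL ω W.edges := by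
  rw [fppT_eq]
  apply csInf_le
  · exact ⟨0, by rintro _ ⟨W, rfl⟩; exact tmL_nonneg ha hab hω W⟩
  · exact ⟨W, rfl⟩

theorem exists_geo {d n : ℕ} {a b : ℝ} (ha : 0 < a) (hab : a < b) {ω : Sym2 (Vtx d) → ℝ}
    (hω : ValidEnv d n a b ω) (v : Vtx d)
    (hne : Nonempty ((boxG d n).Walk 0 (fun i => (n : ℤ) * v i))) :
    ∃ W : (boxG d n).Walk 0 (fun i => (n : ℤ) * v i), W.edges.Nodup ∧
      fppT d v n ω = tmL ω W.edges := by
  set R := Set.range fun W : (boxG d n).Walk 0 (fun i => (n : ℤ) * v i) =>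
      tmL ω W.edges with hR
  have hRne : R.Nonempty := Set.range_nonempty _
  have hsub : R ⊆ (AddSubmonoid.closure ({a, b} : Set ℝ) : Set ℝ) := by
    rintro _ ⟨W, rfl⟩
    apply AddSubmonoid.list_sum_mem
    intro t ht
    obtain ⟨e, he, rfl⟩ := List.mem_map.1 ht
    apply AddSubmonoid.subset_closure
    rcases hω e (edge_mem (W.edges_subset_edgeSet he)) with h | h <;> simp [h]
  have hpwo : (AddSubmonoid.closure ({a, b} : Set ℝ) : Set ℝ).IsPWO := by
    apply Set.IsPWO.addSubmonoid_closure
    · rintro x (rfl | rfl) <;> linarith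
    · exact (Set.toFinite _).isPWO
  have hwf : R.IsWF := (hpwo.mono hsub).isWF
  obtain ⟨W, hW⟩ := hwf.min_mem hRne
  classical
  refine ⟨W.bypass, W.bypass_isPath.isTrail.edges_nodup, le_antisymm
    (fppT_le ha hab hω v _) ?_⟩
  rw [fppT_eq]
  apply le_csInf hRne
  intro t ht
  have h1 : hwf.min hRne ≤ t := hwf.min_le hRne ht
  have h2 : tmL ω W.bypass.edges ≤ tmL ω W.edges := by
    obtain ⟨l, hperm, hsub⟩ := List.subperm_of_subset
      W.bypass_isPath.isTrail.edges_nodup W.edges_bypass_subset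
    have hs : tmL ω W.bypass.edges = tmL ω l := (hperm.map ω).sum_eq.symm
    rw [hs]
    apply List.Sublist.sum_le_sum (l₁ := l.map ω) (hsub.map ω)
    intro t ht
    obtain ⟨e, he, rfl⟩ := List.mem_map.1 ht
    rcases hω e (edge_mem (W.edges_subset_edgeSet he)) with h | h <;> rw [h] <;> linarith
  simp only at hW
  linarith

theorem walk_split {V : Type*} {G : SimpleGraph V} {u w : V} (W : G.Walk u w) :
    ∀ (A B : List (Sym2 V)) (e : Sym2 V), W.edges = A ++ e :: B →
    ∃ x y, ∃ _ : G.Adj x y, ∃ (W1 : G.Walk u x) (W2 : G.Walk y w),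
      e = s(x, y) ∧ W1.edges = A ∧ W2.edges = B := by
  induction W with
  | nil => intro A B e h; simp at h
  | @cons u t w h p ih =>
    intro A B e hE
    rw [SimpleGraph.Walk.edges_cons] at hE
    cases A with
    | nil =>
      simp only [List.nil_append, List.cons.injEq] at hE
      exact ⟨u, t, h, SimpleGraph.Walk.nil, p, hE.1.symm, by simp, hE.2⟩
    | cons e' A =>
      simp only [List.cons_append, List.cons.injEq] at hE
      obtain ⟨x, y, hxy, W1, W2, h1, h2, h3⟩ := ih A B e hE.2
      exact ⟨x, y, hxy, SimpleGraph.Walk.cons h W1, W2, h1, by simp [h2, hE.1], h3⟩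

theorem tmL_append {E : Type*} (ω : E → ℝ) (A B : List E) :
    tmL ω (A ++ B) = tmL ω A + tmL ω B := by simp [tmL]

theorem tmL_cons {E : Type*} (ω : E → ℝ) (e : E) (B : List E) :
    tmL ω (e :: B) = ω e + tmL ω B := by simp [tmL]

theorem tmL_upd_notMem {E : Type*} [DecidableEq E] (ω : E → ℝ) (e : E) (t : ℝ) (L : List E)
    (h : e ∉ L) : tmL (Function.update ω e t) L = tmL ω L := by
  unfold tmL
  congr 1
  apply List.map_congr_left
  intro x hx
  rw [Function.update_of_ne]
  rintro rfl
  exact h hx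

theorem valid_update {d n : ℕ} {a b : ℝ} {ω : Sym2 (Vtx d) → ℝ}
    (hω : ValidEnv d n a b ω) (e : Sym2 (Vtx d)) {t : ℝ} (ht : t = a ∨ t = b) :
    ValidEnv d n a b (Function.update ω e t) := by
  intro x hx
  by_cases h : x = e
  · subst h; simpa using ht
  · rw [Function.update_of_ne h]; exact hω x hx

/-- Exchange of the two walks at a common edge. -/
theorem exchange {d n : ℕ} {a b : ℝ} (ha : 0 < a) (hab : a < b) {η : Sym2 (Vtx d) → ℝ}
    (hη : ValidEnv d n a b η) (v : Vtx d) (i e k : Sym2 (Vtx d)) (hie : i ≠ e) (hke : k ≠ e)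
    (P Q : (boxG d n).Walk 0 (fun i => (n : ℤ) * v i)) (A B : List (Sym2 (Vtx d)))
    (hP : P.edges = A ++ e :: B) (hkA : k ∉ A) (hiB : i ∉ B) (he : e ∈ Q.edges)
    (hi : i ∉ Q.edges) (hk : k ∉ Q.edges) :
    fppT d v n (Function.update η k b) + fppT d v n (Function.update η i b) ≤
      tmL η P.edges + tmL η Q.edges := by
  obtain ⟨C, D, hQ⟩ := List.append_of_mem he
  obtain ⟨x, y, hxy, P1, P2, h1, h2, h3⟩ := walk_split P A B e hP
  obtain ⟨x', y', hxy', Q1, Q2, h1', h2', h3'⟩ := walk_split Q C D e hQ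
  have hk' := valid_update hη k (Or.inr rfl : b = a ∨ b = b)
  have hi' := valid_update hη i (Or.inr rfl : b = a ∨ b = b)
  rw [hQ] at hi hk
  simp only [List.mem_append, List.mem_cons, not_or] at hi hk
  have hpos : 0 ≤ η e := by
    rcases hη e (edge_mem (Q.edges_subset_edgeSet he)) with h | h <;> rw [h] <;> linarith
  rw [hP, hQ]
  simp only [tmL_append, tmL_cons]
  rw [h1, Sym2.eq_iff] at h1'
  rcases h1' with ⟨rfl, rfl⟩ | ⟨rfl, rfl⟩
  · have e1 := fppT_le ha hab hk' v (P1.append (SimpleGraph.Walk.cons hxy Q2))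
    have e2 := fppT_le ha hab hi' v (Q1.append (SimpleGraph.Walk.cons hxy P2))
    rw [SimpleGraph.Walk.edges_append, SimpleGraph.Walk.edges_cons, h2, h3', ← h1,
      tmL_upd_notMem _ _ _ _ (by simp; tauto), tmL_append, tmL_cons] at e1
    rw [SimpleGraph.Walk.edges_append, SimpleGraph.Walk.edges_cons, h2', h3, ← h1,
      tmL_upd_notMem _ _ _ _ (by simp; tauto), tmL_append, tmL_cons] at e2
    linarith
  · have e1 := fppT_le ha hab hk' v (P1.append Q2)
    have e2 := fppT_le ha hab hi' v (Q1.append P2)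
    rw [SimpleGraph.Walk.edges_append, h2, h3',
      tmL_upd_notMem _ _ _ _ (by simp; tauto), tmL_append] at e1
    rw [SimpleGraph.Walk.edges_append, h2', h3,
      tmL_upd_notMem _ _ _ _ (by simp; tauto), tmL_append] at e2
    linarith

theorem mid_of_lt {E : Type*} [DecidableEq E] (L : List E) (hL : L.Nodup) (i e k : E)
    (he : e ∈ L) (h1 : L.idxOf i < L.idxOf e) (h2 : L.idxOf e < L.idxOf k) :
    ∃ A B, L = A ++ e :: B ∧ k ∉ A ∧ i ∉ B := by
  obtain ⟨A, B, rfl⟩ := List.append_of_mem he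
  refine ⟨A, B, rfl, ?_, ?_⟩
  · intro hk
    have heA : e ∉ A := by grind
    rw [List.idxOf_append_of_mem hk, List.idxOf_append_of_notMem heA] at h2
    have := List.idxOf_lt_length_of_mem hk
    omega
  · intro hi
    have heA : e ∉ A := by grind
    have hiA : i ∉ A := by grind
    rw [List.idxOf_append_of_notMem hiA, List.idxOf_append_of_notMem heA] at h1
    simp at h1

theorem mid_cases {E : Type*} [DecidableEq E] (L : List E) (hL : L.Nodup) (e1 e2 e3 : E)
    (h12 : e1 ≠ e2) (h13 : e1 ≠ e3) (h23 : e2 ≠ e3)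
    (m1 : e1 ∈ L) (m2 : e2 ∈ L) (m3 : e3 ∈ L) (M : E → E → E → Prop)
    (hM : ∀ i e k, M i e k ↔ ∃ A B, L = A ++ e :: B ∧ k ∉ A ∧ i ∉ B) :
    (M e1 e2 e3 ∨ M e3 e2 e1) ∨ (M e2 e1 e3 ∨ M e3 e1 e2) ∨ (M e1 e3 e2 ∨ M e2 e3 e1) := by
  have n12 : L.idxOf e1 ≠ L.idxOf e2 := fun h => h12 ((List.idxOf_inj m1).1 h)
  have n13 : L.idxOf e1 ≠ L.idxOf e3 := fun h => h13 ((List.idxOf_inj m1).1 h)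
  have n23 : L.idxOf e2 ≠ L.idxOf e3 := fun h => h23 ((List.idxOf_inj m2).1 h)
  have key : ∀ i e k, e ∈ L → L.idxOf i < L.idxOf e → L.idxOf e < L.idxOf k → M i e k :=
    fun i e k he h1 h2 => (hM i e k).2 (mid_of_lt L hL i e k he h1 h2)
  have a1 := key e1 e2 e3 m2
  have a2 := key e3 e2 e1 m2
  have a3 := key e2 e1 e3 m1
  have a4 := key e3 e1 e2 m1
  have a5 := key e1 e3 e2 m3
  have a6 := key e2 e3 e1 m3
  clear key hM
  generalize L.idxOf e1 = i1 at *
  generalize L.idxOf e2 = i2 at *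
  generalize L.idxOf e3 = i3 at *
  rcases lt_or_gt_of_ne n12 with h | h
  · rcases lt_or_gt_of_ne n23 with h' | h'
    · exact Or.inl (Or.inl (a1 h h'))
    · rcases lt_or_gt_of_ne n13 with h'' | h''
      · exact Or.inr (Or.inr (Or.inl (a5 h'' h')))
      · exact Or.inr (Or.inl (Or.inr (a4 h'' h)))
  · rcases lt_or_gt_of_ne n23 with h' | h'
    · rcases lt_or_gt_of_ne n13 with h'' | h''
      · exact Or.inr (Or.inl (Or.inl (a3 h h'')))
      · exact Or.inr (Or.inr (Or.inr (a6 h' h'')))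
    · exact Or.inl (Or.inr (a2 h' h))

/-- Exchange with the two orders merged. -/
theorem exchange' {d n : ℕ} {a b : ℝ} (ha : 0 < a) (hab : a < b) {η : Sym2 (Vtx d) → ℝ}
    (hη : ValidEnv d n a b η) (v : Vtx d) (i e k : Sym2 (Vtx d)) (hie : i ≠ e) (hke : k ≠ e)
    (P Q : (boxG d n).Walk 0 (fun i => (n : ℤ) * v i))
    (hP : (∃ A B, P.edges = A ++ e :: B ∧ k ∉ A ∧ i ∉ B) ∨
      (∃ A B, P.edges = A ++ e :: B ∧ i ∉ A ∧ k ∉ B)) (he : e ∈ Q.edges)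
    (hi : i ∉ Q.edges) (hk : k ∉ Q.edges) :
    fppT d v n (Function.update η k b) + fppT d v n (Function.update η i b) ≤
      tmL η P.edges + tmL η Q.edges := by
  rcases hP with ⟨A, B, h1, h2, h3⟩ | ⟨A, B, h1, h2, h3⟩
  · exact exchange ha hab hη v i e k hie hke P Q A B h1 h2 h3 he hi hk
  · rw [add_comm (fppT d v n _)]
    exact exchange ha hab hη v k e i hke hie P Q A B h1 h2 h3 he hk hi

theorem count01 {E : Type*} [DecidableEq E] (L : List E) (hL : L.Nodup) (e : E) :
    ((L.count e : ℝ) = 0 ∧ e ∉ L) ∨ ((L.count e : ℝ) = 1 ∧ e ∈ L) := by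
  by_cases h : e ∈ L
  · right; exact ⟨by rw [List.count_eq_one_of_mem hL h]; simp, h⟩
  · left; exact ⟨by rw [List.count_eq_zero_of_not_mem h]; simp, h⟩

theorem third_aux {d n : ℕ} {a b : ℝ} (ha : 0 < a) (hab : a < b) {ω : Sym2 (Vtx d) → ℝ}
    (hω : ValidEnv d n a b ω) (v : Vtx d) (e1 e2 e3 : Sym2 (Vtx d))
    (h12 : e1 ≠ e2) (h13 : e1 ≠ e3) (h23 : e2 ≠ e3)
    (hne : Nonempty ((boxG d n).Walk 0 (fun i => (n : ℤ) * v i)))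
    (f : ℝ → ℝ → ℝ → ℝ) (hf : ∀ x y z, f x y z = fppT d v n
      (Function.update (Function.update (Function.update ω e1 x) e2 y) e3 z)) :
    f b b b + f b a a + f a b a + f a a b ≤ f b b a + f b a b + f a b b + f a a a + (b - a) := by
  set env : ℝ → ℝ → ℝ → (Sym2 (Vtx d) → ℝ) := fun x y z =>
    Function.update (Function.update (Function.update ω e1 x) e2 y) e3 z with henv
  have hfe : ∀ x y z, f x y z = fppT d v n (env x y z) := hf
  have hval : ∀ x y z, (x = a ∨ x = b) → (y = a ∨ y = b) → (z = a ∨ z = b) →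
      ValidEnv d n a b (env x y z) := fun x y z hx hy hz =>
    valid_update (valid_update (valid_update hω _ hx) _ hy) _ hz
  have htm : ∀ x y z L, tmL (env x y z) L = tmL (env 0 0 0) L
      + L.count e1 * x + L.count e2 * y + L.count e3 * z := fun x y z L =>
    tmL_update ω e1 e2 e3 h12 h13 h23 x y z L
  have ub : ∀ x y z, (x = a ∨ x = b) → (y = a ∨ y = b) → (z = a ∨ z = b) →
      ∀ W : (boxG d n).Walk 0 (fun i => (n : ℤ) * v i), f x y z ≤ tmL (env 0 0 0) W.edges
      + W.edges.count e1 * x + W.edges.count e2 * y + W.edges.count e3 * z := by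
    intro x y z hx hy hz W
    rw [hf, ← htm]
    exact fppT_le ha hab (hval x y z hx hy hz) v W
  have ex : ∀ x y z, (x = a ∨ x = b) → (y = a ∨ y = b) → (z = a ∨ z = b) →
      ∃ W : (boxG d n).Walk 0 (fun i => (n : ℤ) * v i), W.edges.Nodup ∧
      f x y z = tmL (env 0 0 0) W.edges
      + W.edges.count e1 * x + W.edges.count e2 * y + W.edges.count e3 * z := by
    intro x y z hx hy hz
    obtain ⟨W, h1, h2⟩ := exists_geo ha hab (hval x y z hx hy hz) v hne
    exact ⟨W, h1, by rw [hf, ← htm]; exact h2⟩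
  have oa : a = a ∨ a = b := Or.inl rfl
  have ob : b = a ∨ b = b := Or.inr rfl
  obtain ⟨P0, n0, g0⟩ := ex a a a oa oa oa
  obtain ⟨P1, n1, g1⟩ := ex a b b oa ob ob
  obtain ⟨P2, n2, g2⟩ := ex b a b ob oa ob
  obtain ⟨P3, n3, g3⟩ := ex b b a ob ob oa
  have x1 : (∃ A B, P0.edges = A ++ e1 :: B ∧ e3 ∉ A ∧ e2 ∉ B) ∨
      (∃ A B, P0.edges = A ++ e1 :: B ∧ e2 ∉ A ∧ e3 ∉ B) → e1 ∈ P1.edges → e2 ∉ P1.edges →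
      e3 ∉ P1.edges → f a a b + f a b a ≤ f a a a + f a b b := by
    intro hm q1 q2 q3
    have := exchange' ha hab (hval a a a oa oa oa) v e2 e1 e3 h12.symm h13.symm P0 P1 hm q1 q2 q3
    rw [htm a a a P0.edges, htm a a a P1.edges] at this
    rw [hfe a a b, hfe a b a, g0, g1]
    have u1 : Function.update (env a a a) e3 b = env a a b := by simp [henv]
    have u2 : Function.update (env a a a) e2 b = env a b a := by
      simp [henv, Function.update_comm h23]
    rw [u1, u2] at this
    have c2 := List.count_eq_zero_of_not_mem q2
    have c3 := List.count_eq_zero_of_not_mem q3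
    simp only [c2, c3] at this ⊢
    push_cast at this ⊢
    linarith
  have x2 : (∃ A B, P0.edges = A ++ e2 :: B ∧ e3 ∉ A ∧ e1 ∉ B) ∨
      (∃ A B, P0.edges = A ++ e2 :: B ∧ e1 ∉ A ∧ e3 ∉ B) → e2 ∈ P2.edges → e1 ∉ P2.edges →
      e3 ∉ P2.edges → f a a b + f b a a ≤ f a a a + f b a b := by
    intro hm q1 q2 q3
    have := exchange' ha hab (hval a a a oa oa oa) v e1 e2 e3 h12 h23.symm P0 P2 hm q1 q2 q3
    rw [htm a a a P0.edges, htm a a a P2.edges] at this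
    rw [hfe a a b, hfe b a a, g0, g2]
    have u1 : Function.update (env a a a) e3 b = env a a b := by simp [henv]
    have u2 : Function.update (env a a a) e1 b = env b a a := by
      simp [henv, Function.update_comm h12, Function.update_comm h13]
    rw [u1, u2] at this
    have c2 := List.count_eq_zero_of_not_mem q2
    have c3 := List.count_eq_zero_of_not_mem q3
    simp only [c2, c3] at this ⊢
    push_cast at this ⊢
    linarith
  have x3 : (∃ A B, P0.edges = A ++ e3 :: B ∧ e2 ∉ A ∧ e1 ∉ B) ∨
      (∃ A B, P0.edges = A ++ e3 :: B ∧ e1 ∉ A ∧ e2 ∉ B) → e3 ∈ P3.edges → e1 ∉ P3.edges →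
      e2 ∉ P3.edges → f a b a + f b a a ≤ f a a a + f b b a := by
    intro hm q1 q2 q3
    have := exchange' ha hab (hval a a a oa oa oa) v e1 e3 e2 h13 h23 P0 P3 hm q1 q2 q3
    rw [htm a a a P0.edges, htm a a a P3.edges] at this
    rw [hfe a b a, hfe b a a, g0, g3]
    have u1 : Function.update (env a a a) e2 b = env a b a := by
      simp [henv, Function.update_comm h23]
    have u2 : Function.update (env a a a) e1 b = env b a a := by
      simp [henv, Function.update_comm h12, Function.update_comm h13]
    rw [u1, u2] at this
    have c2 := List.count_eq_zero_of_not_mem q2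
    have c3 := List.count_eq_zero_of_not_mem q3
    simp only [c2, c3] at this ⊢
    push_cast at this ⊢
    linarith
  have mid := fun m1 m2 m3 => mid_cases P0.edges n0 e1 e2 e3 h12 h13 h23 m1 m2 m3 _
    (fun i e k => Iff.rfl)
  -- all upper bounds at the four geodesics
  have hc : 0 < b - a := by linarith
  have A1 := ub b a a ob oa oa
  have A2 := ub a b a oa ob oa
  have A3 := ub a a b oa oa ob
  have AB := ub b b b ob ob ob
  have A1P0 := A1 P0
  have A2P0 := A2 P0
  have A3P0 := A3 P0
  have A2P1 := A2 P1
  have A3P1 := A3 P1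
  have A1P2 := A1 P2
  have A3P2 := A3 P2
  have A1P3 := A1 P3
  have A2P3 := A2 P3
  have AB1 := AB P1
  have AB2 := AB P2
  have AB3 := AB P3
  clear A1 A2 A3 AB ub ex htm hval hf hfe
  generalize tmL (env 0 0 0) P0.edges = t0 at *
  generalize tmL (env 0 0 0) P1.edges = t1 at *
  generalize tmL (env 0 0 0) P2.edges = t2 at *
  generalize tmL (env 0 0 0) P3.edges = t3 at *
  have c01 := count01 P0.edges n0 e1
  have c02 := count01 P0.edges n0 e2
  have c03 := count01 P0.edges n0 e3
  have c11 := count01 P1.edges n1 e1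
  have c12 := count01 P1.edges n1 e2
  have c13 := count01 P1.edges n1 e3
  have c21 := count01 P2.edges n2 e1
  have c22 := count01 P2.edges n2 e2
  have c23 := count01 P2.edges n2 e3
  have c31 := count01 P3.edges n3 e1
  have c32 := count01 P3.edges n3 e2
  have c33 := count01 P3.edges n3 e3
  generalize (P0.edges.count e1 : ℝ) = k01 at *
  generalize (P0.edges.count e2 : ℝ) = k02 at *
  generalize (P0.edges.count e3 : ℝ) = k03 at *
  generalize (P1.edges.count e1 : ℝ) = k11 at *
  generalize (P1.edges.count e2 : ℝ) = k12 at *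
  generalize (P1.edges.count e3 : ℝ) = k13 at *
  generalize (P2.edges.count e1 : ℝ) = k21 at *
  generalize (P2.edges.count e2 : ℝ) = k22 at *
  generalize (P2.edges.count e3 : ℝ) = k23 at *
  generalize (P3.edges.count e1 : ℝ) = k31 at *
  generalize (P3.edges.count e2 : ℝ) = k32 at *
  generalize (P3.edges.count e3 : ℝ) = k33 at *
  have p1 : ∀ {k : ℝ} {p : Prop}, (k = 0 ∧ ¬ p) ∨ (k = 1 ∧ p) →
      k * a ≤ k * b ∧ k * b ≤ k * a + (b - a) := by
    rintro k p (⟨rfl, -⟩ | ⟨rfl, -⟩) <;> constructor <;> linarith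
  have q01 := p1 c01
  have q02 := p1 c02
  have q03 := p1 c03
  have q11 := p1 c11
  have q12 := p1 c12
  have q13 := p1 c13
  have q21 := p1 c21
  have q22 := p1 c22
  have q23 := p1 c23
  have q31 := p1 c31
  have q32 := p1 c32
  have q33 := p1 c33
  rcases c11 with ⟨rfl, -⟩ | ⟨rfl, m11⟩
  · linarith
  rcases c22 with ⟨rfl, -⟩ | ⟨rfl, m22⟩
  · linarith
  rcases c33 with ⟨rfl, -⟩ | ⟨rfl, m33⟩
  · linarith
  rcases c01 with ⟨rfl, -⟩ | ⟨rfl, m01⟩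
  · linarith
  rcases c02 with ⟨rfl, -⟩ | ⟨rfl, m02⟩
  · linarith
  rcases c03 with ⟨rfl, -⟩ | ⟨rfl, m03⟩
  · linarith
  rcases c12 with ⟨rfl, m12⟩ | ⟨rfl, -⟩
  swap
  · linarith
  rcases c13 with ⟨rfl, m13⟩ | ⟨rfl, -⟩
  swap
  · linarith
  rcases c21 with ⟨rfl, m21⟩ | ⟨rfl, -⟩
  swap
  · linarith
  rcases c23 with ⟨rfl, m23⟩ | ⟨rfl, -⟩
  swap
  · linarith
  rcases c31 with ⟨rfl, m31⟩ | ⟨rfl, -⟩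
  swap
  · linarith
  rcases c32 with ⟨rfl, m32⟩ | ⟨rfl, -⟩
  swap
  · linarith
  rcases mid m01 m02 m03 with h | h | h
  · have := x2 h m22 m21 m23
    linarith
  · have := x1 h m11 m12 m13
    linarith
  · have := x3 h m33 m31 m32
    linarith

/--
For every subset `S ⊆ W_n` with exactly three elements and every
environment `ω ∈ Ω_n`, the third-order environment derivative of the first-passage
percolation time satisfies `∂_S f(ω) ≤ b − a`.
-/
theorem fpp_third_deriv_le (d : ℕ) (hd : 2 ≤ d) (a b : ℝ) (ha : 0 < a) (hab : a < b)
    (v : Vtx d) (hv : ∀ i, |v i| ≤ 2) (n : ℕ)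
    (S : Finset (Sym2 (Vtx d))) (hS : ↑S ⊆ EdgeSet d n) (hcard : S.card = 3)
    (ω : Sym2 (Vtx d) → ℝ) (hω : ValidEnv d n a b ω) :
    envDerivOn a b S (fppT d v n) ω ≤ b - a := by
  classical
  by_cases hne : Nonempty ((boxG d n).Walk 0 (fun i => (n : ℤ) * v i))
  · have hlen : S.toList.length = 3 := by simp [hcard]
    have hnd := S.nodup_toList
    unfold envDerivOn
    obtain ⟨e1, e2, e3, hL⟩ := List.length_eq_three.1 hlen
    rw [hL] at hnd ⊢
    simp only [List.nodup_cons, List.mem_cons, List.not_mem_nil, or_false, not_or] at hnd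
    have := third_aux ha hab hω v e1 e2 e3 hnd.1.1 hnd.1.2 hnd.2.1 hne _ (fun x y z => rfl)
    simp only [List.foldr_cons, List.foldr_nil, envDeriv]
    linarith
  · have h0 : ∀ η, fppT d v n η = 0 := by
      intro η
      rw [fppT_eq]
      have : IsEmpty ((boxG d n).Walk 0 (fun i => (n : ℤ) * v i)) := not_nonempty_iff.1 hne
      rw [Set.range_eq_empty, Real.sInf_empty]
    have hlen : S.toList.length = 3 := by simp [hcard]
    obtain ⟨e1, e2, e3, hL⟩ := List.length_eq_three.1 hlen
    unfold envDerivOn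
    rw [hL]
    simp only [List.foldr_cons, List.foldr_nil, envDeriv, h0]
    linarith

end
end

section
/- For every subset S ⊆ W with exactly three elements and every environment ω ∈ Ω, the third-order environment derivative of the first-passage percolation time satisfies ∂_S f(ω) ≥ −(b−a). -/
noncomputable section

lemma edgesOf_nil {d : ℕ} : edgesOf ([] : List (Vtx d)) = [] := rfl
lemma edgesOf_single {d : ℕ} (x : Vtx d) : edgesOf [x] = [] := rfl
lemma edgesOf_cons {d : ℕ} (x y : Vtx d) (l : List (Vtx d)) :
    edgesOf (x :: y :: l) = s(x, y) :: edgesOf (y :: l) := rfl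

lemma pathTime_eq {d : ℕ} (ω : Sym2 (Vtx d) → ℝ) (p : List (Vtx d)) :
    pathTime ω p = ((edgesOf p).map ω).sum := by
  simp [pathTime, edgesOf, Function.comp_def]

lemma edgesOf_split {d : ℕ} (x : Vtx d) (L R : List (Vtx d)) :
    edgesOf (L ++ x :: R) = edgesOf (L ++ [x]) ++ edgesOf (x :: R) := by
  induction L with
  | nil => simp [edgesOf_single]
  | cons y L ih =>
    cases L with
    | nil => simp [edgesOf_single, edgesOf_cons]
    | cons z L => simpa [edgesOf_cons] using ih

lemma mem_of_mem_edgesOf {d : ℕ} {x : Vtx d} {e : Sym2 (Vtx d)} {p : List (Vtx d)}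
    (he : e ∈ edgesOf p) (hx : x ∈ e) : x ∈ p := by
  induction p with
  | nil => simp [edgesOf_nil] at he
  | cons y p ih =>
    cases p with
    | nil => simp [edgesOf_single] at he
    | cons z p =>
      rw [edgesOf_cons, List.mem_cons] at he
      rcases he with rfl | he
      · rw [Sym2.mem_iff] at hx
        rcases hx with rfl | rfl <;> simp
      · exact List.mem_cons_of_mem _ (ih he)

lemma edgesOf_nodup {d : ℕ} {p : List (Vtx d)} (hp : p.Nodup) : (edgesOf p).Nodup := by
  induction p with
  | nil => simp [edgesOf_nil]
  | cons y p ih =>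
    cases p with
    | nil => simp [edgesOf_single]
    | cons z p =>
      rw [edgesOf_cons, List.nodup_cons]
      rw [List.nodup_cons] at hp
      exact ⟨fun h => hp.1 (mem_of_mem_edgesOf h (Sym2.mem_mk_left _ _)), ih hp.2⟩

lemma edgesOf_mem_EdgeSet {d n : ℕ} {u w : Vtx d} {p : List (Vtx d)} (hp : IsPath n u w p) :
    ∀ e ∈ edgesOf p, e ∈ EdgeSet d n := by
  obtain ⟨h1, -, -, h4⟩ := hp
  induction p with
  | nil => simp [edgesOf_nil]
  | cons y p ih =>
    cases p with
    | nil => simp [edgesOf_single]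
    | cons z p =>
      intro e he
      rw [edgesOf_cons, List.mem_cons] at he
      have h1' := List.isChain_cons_cons.1 h1
      rcases he with rfl | he
      · exact ⟨y, z, rfl, h1'.1, h4 _ (by simp), h4 _ (by simp)⟩
      · exact ih h1'.2 (fun x hx => h4 x (List.mem_cons_of_mem _ hx)) e he

lemma isPath_splice {d n : ℕ} {u w x : Vtx d} {L R L' R' : List (Vtx d)}
    (h : IsPath n u w (L ++ x :: R)) (h' : IsPath n u w (L' ++ x :: R')) :
    IsPath n u w (L ++ x :: R') := by
  obtain ⟨h1, h2, h3, h4⟩ := h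
  obtain ⟨h1', h2', h3', h4'⟩ := h'
  refine ⟨?_, ?_, ?_, ?_⟩
  · exact List.isChain_split.2 ⟨(List.isChain_split.1 h1).1, (List.isChain_split.1 h1').2⟩
  · cases L <;> simpa using h2
  · simpa [List.getLast?_append] using h3'
  · intro y hy
    rw [List.mem_append] at hy
    rcases hy with hy | hy
    · exact h4 y (by simp [hy])
    · exact h4' y (List.mem_append_right _ hy)

/-- all edge weights in the box are nonnegative -/
def NN (d n : ℕ) (ω : Sym2 (Vtx d) → ℝ) : Prop := ∀ e ∈ EdgeSet d n, 0 ≤ ω e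

lemma sum_map_nonneg' {E : Type*} (ω : E → ℝ) (l : List E) (h : ∀ e ∈ l, 0 ≤ ω e) :
    0 ≤ (l.map ω).sum := by
  apply List.sum_nonneg
  intro x hx
  obtain ⟨e, he, rfl⟩ := List.mem_map.1 hx
  exact h e he

lemma pathTime_nonneg {d n : ℕ} {ω : Sym2 (Vtx d) → ℝ} (hω : NN d n ω) {u w : Vtx d}
    {p : List (Vtx d)} (hp : IsPath n u w p) : 0 ≤ pathTime ω p := by
  rw [pathTime_eq]
  exact sum_map_nonneg' _ _ fun e he => hω e (edgesOf_mem_EdgeSet hp e he)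

lemma exists_nodup {d n : ℕ} {ω : Sym2 (Vtx d) → ℝ} (hω : NN d n ω) {w : Vtx d}
    (p : List (Vtx d)) : ∀ u, IsPath n u w p →
    ∃ q, IsPath n u w q ∧ q.Nodup ∧ pathTime ω q ≤ pathTime ω p := by
  induction p with
  | nil => intro u h; simp [IsPath] at h
  | cons y p ih =>
    intro u h
    cases p with
    | nil => exact ⟨[y], h, by simp, le_rfl⟩
    | cons z p =>
      have hmem := edgesOf_mem_EdgeSet h
      obtain ⟨h1, h2, h3, h4⟩ := h
      have h1' := List.isChain_cons_cons.1 h1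
      simp only [List.head?_cons, Option.some.injEq] at h2
      subst h2
      obtain ⟨q, hq, hqn, hqt⟩ := ih z ⟨h1'.2, by simp, by simpa using h3,
        fun x hx => h4 x (List.mem_cons_of_mem _ hx)⟩
      have hw : 0 ≤ ω s(y, z) := hω _ (hmem _ (by simp [edgesOf_cons]))
      have hT : pathTime ω (y :: z :: p) = ω s(y, z) + pathTime ω (z :: p) := by
        simp [pathTime_eq, edgesOf_cons]
      by_cases hy : y ∈ q
      · obtain ⟨L, R, rfl⟩ := List.append_of_mem hy
        obtain ⟨g1, g2, g3, g4⟩ := hq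
        have hle : ∀ e ∈ edgesOf (L ++ [y]), 0 ≤ ω e := by
          intro e he
          exact hω e (edgesOf_mem_EdgeSet ⟨g1, g2, g3, g4⟩ e (by
            rw [edgesOf_split]; exact List.mem_append_left _ he))
        refine ⟨y :: R, ⟨(List.isChain_split.1 g1).2, rfl, ?_, ?_⟩, ?_, ?_⟩
        · simpa [List.getLast?_append] using g3
        · exact fun x hx => g4 x (List.mem_append_right _ hx)
        · exact (List.nodup_append.1 hqn).2.1
        · have := sum_map_nonneg' _ _ hle
          have e2 : pathTime ω (L ++ y :: R)
              = ((edgesOf (L ++ [y])).map ω).sum + pathTime ω (y :: R) := by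
            rw [pathTime_eq, pathTime_eq, edgesOf_split]; simp
          linarith
      · cases q with
        | nil => simp [IsPath] at hq
        | cons z' q =>
          obtain ⟨g1, g2, g3, g4⟩ := hq
          simp only [List.head?_cons, Option.some.injEq] at g2
          subst g2
          refine ⟨y :: z' :: q, ⟨List.isChain_cons_cons.2 ⟨h1'.1, g1⟩, rfl, by simpa using g3, ?_⟩,
            List.nodup_cons.2 ⟨hy, hqn⟩, ?_⟩
          · intro x hx
            rcases List.mem_cons.1 hx with rfl | hx
            · exact h4 _ (by simp)
            · exact g4 x hx
          · have e2 : pathTime ω (y :: z' :: q) = ω s(y, z') + pathTime ω (z' :: q) := by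
              simp [pathTime_eq, edgesOf_cons]
            linarith

lemma before_split {d : ℕ} [DecidableEq (Sym2 (Vtx d))] {x : Vtx d} {e e' : Sym2 (Vtx d)}
    (hx : x ∈ e') (p : List (Vtx d)) (hp : p.Nodup) (he' : e' ∈ edgesOf p)
    (hlt : (edgesOf p).idxOf e < (edgesOf p).idxOf e') :
    ∃ L R, p = L ++ x :: R ∧ e ∉ edgesOf (x :: R) := by
  induction p with
  | nil => simp [edgesOf_nil] at he'
  | cons y p ih =>
    cases p with
    | nil => simp [edgesOf_single] at he'
    | cons z p =>
      rw [List.nodup_cons] at hp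
      have hne : s(y, z) ≠ e' := by
        rintro rfl
        simp [edgesOf_cons] at hlt
      have hm : e' ∈ edgesOf (z :: p) := by
        rw [edgesOf_cons, List.mem_cons] at he'
        exact he'.resolve_left (fun h => hne h.symm)
      by_cases h : s(y, z) = e
      · obtain ⟨L, R, hLR⟩ := List.append_of_mem (mem_of_mem_edgesOf hm hx)
        refine ⟨y :: L, R, by rw [hLR]; rfl, fun hmem => hp.1 ?_⟩
        rw [hLR]
        exact List.mem_append_right _ (mem_of_mem_edgesOf hmem (h ▸ Sym2.mem_mk_left y z))
      · rw [edgesOf_cons, List.idxOf_cons_ne _ h, List.idxOf_cons_ne _ hne] at hlt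
        obtain ⟨L, R, hLR, hn⟩ := ih hp.2 hm (by omega)
        exact ⟨y :: L, R, by rw [hLR]; rfl, hn⟩

lemma after_split {d : ℕ} [DecidableEq (Sym2 (Vtx d))] {x : Vtx d} {e e' : Sym2 (Vtx d)}
    (hx : x ∈ e') (p : List (Vtx d)) (he' : e' ∈ edgesOf p)
    (hlt : (edgesOf p).idxOf e' < (edgesOf p).idxOf e) :
    ∃ L R, p = L ++ x :: R ∧ e ∉ edgesOf (L ++ [x]) := by
  induction p with
  | nil => simp [edgesOf_nil] at he'
  | cons y p ih =>
    cases p with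
    | nil => simp [edgesOf_single] at he'
    | cons z p =>
      have hne : s(y, z) ≠ e := by
        rintro rfl
        simp [edgesOf_cons] at hlt
      by_cases h : s(y, z) = e'
      · rw [← h, Sym2.mem_iff] at hx
        rcases hx with rfl | rfl
        · exact ⟨[], z :: p, rfl, by simp [edgesOf_single]⟩
        · refine ⟨[y], p, rfl, ?_⟩
          simpa [edgesOf_cons, edgesOf_single] using hne.symm
      · have hm : e' ∈ edgesOf (z :: p) := by
          rw [edgesOf_cons, List.mem_cons] at he'
          exact he'.resolve_left (fun h' => h h'.symm)
        rw [edgesOf_cons, List.idxOf_cons_ne _ h, List.idxOf_cons_ne _ hne] at hlt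
        obtain ⟨L, R, hLR, hn⟩ := ih hm (by omega)
        refine ⟨y :: L, R, by rw [hLR]; rfl, ?_⟩
        cases L with
        | nil =>
          simp only [List.nil_append, List.cons.injEq] at hLR
          obtain ⟨rfl, rfl⟩ := hLR
          simpa [edgesOf_cons, edgesOf_single] using hne.symm
        | cons z' L =>
          simp only [List.cons_append, List.cons.injEq] at hLR
          obtain ⟨rfl, -⟩ := hLR
          simp only [List.cons_append, edgesOf_cons, List.mem_cons, not_or]
          exact ⟨hne.symm, hn⟩

lemma pathTime_congr {d : ℕ} {ω ω' : Sym2 (Vtx d) → ℝ} {p : List (Vtx d)}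
    (h : ∀ e ∈ edgesOf p, ω e = ω' e) : pathTime ω p = pathTime ω' p := by
  rw [pathTime_eq, pathTime_eq, List.map_congr_left h]

lemma pathTime_mono {d n : ℕ} {ω ω' : Sym2 (Vtx d) → ℝ} (h : ∀ e ∈ EdgeSet d n, ω e ≤ ω' e)
    {u w : Vtx d} {p : List (Vtx d)} (hp : IsPath n u w p) : pathTime ω p ≤ pathTime ω' p := by
  rw [pathTime_eq, pathTime_eq]
  exact List.sum_le_sum fun e he => h e (edgesOf_mem_EdgeSet hp e he)

lemma sum_lip {E : Type*} {ω ω' : E → ℝ} {e : E} {δ : ℝ} (hδ : 0 ≤ δ)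
    (h : ∀ e', e' ≠ e → ω' e' = ω e') (he : ω' e = ω e + δ) (l : List E) (hl : l.Nodup) :
    (l.map ω').sum ≤ (l.map ω).sum + δ := by
  induction l with
  | nil => simpa using hδ
  | cons x l ih =>
    rw [List.nodup_cons] at hl
    simp only [List.map_cons, List.sum_cons]
    by_cases hx : x = e
    · subst hx
      have : l.map ω' = l.map ω := List.map_congr_left fun y hy => h y (by rintro rfl; exact hl.1 hy)
      rw [this, he]; linarith
    · rw [h x hx]; linarith [ih hl.2]

lemma sum_gain {E : Type*} {ω ω' : E → ℝ} {e : E} {δ : ℝ} (hδ : 0 ≤ δ)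
    (h : ∀ e', e' ≠ e → ω' e' = ω e') (he : ω' e = ω e + δ) (l : List E) (hl : e ∈ l) :
    (l.map ω).sum + δ ≤ (l.map ω').sum := by
  have hle : ∀ x, ω x ≤ ω' x := fun x => by
    by_cases hx : x = e
    · rw [hx, he]; linarith
    · rw [h x hx]
  induction l with
  | nil => simp at hl
  | cons x l ih =>
    simp only [List.map_cons, List.sum_cons]
    by_cases hx : x = e
    · subst hx
      have : (l.map ω).sum ≤ (l.map ω').sum := List.sum_le_sum fun y _ => hle y
      rw [he]; linarith
    · have := ih ((List.mem_cons.1 hl).resolve_left (fun h => hx h.symm))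
      linarith [hle x]

section F
variable {d : ℕ} {v : Vtx d} {n : ℕ}

lemma fppT_le_s10 {ω : Sym2 (Vtx d) → ℝ} (hω : NN d n ω) {p : List (Vtx d)}
    (hp : IsPath n 0 (fun i => (n : ℤ) * v i) p) : fppT d v n ω ≤ pathTime ω p := by
  apply csInf_le
  · refine ⟨0, ?_⟩
    rintro t ⟨q, hq, rfl⟩
    exact pathTime_nonneg hω hq
  · exact ⟨p, hp, rfl⟩

lemma exists_near (hne : ∃ p, IsPath n 0 (fun i => (n : ℤ) * v i) p)
    {ω : Sym2 (Vtx d) → ℝ} (hω : NN d n ω) {ε : ℝ} (hε : 0 < ε) :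
    ∃ p, IsPath n 0 (fun i => (n : ℤ) * v i) p ∧ p.Nodup ∧ pathTime ω p ≤ fppT d v n ω + ε := by
  obtain ⟨p0, hp0⟩ := hne
  obtain ⟨t, ⟨p, hp, rfl⟩, ht⟩ := exists_lt_of_csInf_lt
    (s := {t : ℝ | ∃ p : List (Vtx d), IsPath n 0 (fun i => (n : ℤ) * v i) p ∧ t = pathTime ω p})
    ⟨_, p0, hp0, rfl⟩ (show _ < fppT d v n ω + ε from lt_add_of_pos_right _ hε)
  obtain ⟨q, hq, hqn, hqt⟩ := exists_nodup hω p _ hp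
  exact ⟨q, hq, hqn, by linarith⟩

lemma fppT_mono (hne : ∃ p, IsPath n 0 (fun i => (n : ℤ) * v i) p)
    {ω ω' : Sym2 (Vtx d) → ℝ} (hω : NN d n ω) (h : ∀ e ∈ EdgeSet d n, ω e ≤ ω' e) :
    fppT d v n ω ≤ fppT d v n ω' := by
  refine le_of_forall_pos_le_add fun ε hε => ?_
  obtain ⟨p, hp, -, ht⟩ := exists_near hne (ω := ω') (fun e he => (hω e he).trans (h e he)) hε
  linarith [fppT_le_s10 hω hp, pathTime_mono h hp]

lemma fppT_lip (hne : ∃ p, IsPath n 0 (fun i => (n : ℤ) * v i) p)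
    {ω ω' : Sym2 (Vtx d) → ℝ} (hω : NN d n ω) (hω' : NN d n ω') {e : Sym2 (Vtx d)} {δ : ℝ}
    (hδ : 0 ≤ δ) (h : ∀ e', e' ≠ e → ω' e' = ω e') (he : ω' e = ω e + δ) :
    fppT d v n ω' ≤ fppT d v n ω + δ := by
  refine le_of_forall_pos_le_add fun ε hε => ?_
  obtain ⟨p, hp, hn, ht⟩ := exists_near hne hω hε
  have := fppT_le_s10 hω' hp
  have h2 := sum_lip hδ h he _ (edgesOf_nodup hn)
  rw [pathTime_eq] at *
  linarith

/-- if the near-geodesic avoids `e`, raising `e` costs nothing -/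
lemma fppT_avoid {ω ω' : Sym2 (Vtx d) → ℝ} (hω' : NN d n ω') {e : Sym2 (Vtx d)} {ε : ℝ}
    {p : List (Vtx d)} (hp : IsPath n 0 (fun i => (n : ℤ) * v i) p)
    (ht : pathTime ω p ≤ fppT d v n ω + ε) (hep : e ∉ edgesOf p)
    (h : ∀ e', e' ≠ e → ω' e' = ω e') : fppT d v n ω' ≤ fppT d v n ω + ε := by
  have := fppT_le_s10 hω' hp
  rw [pathTime_congr (ω' := ω) (fun x hx => h x (by rintro rfl; exact hep hx))] at this
  linarith

lemma fppT_gain {ω ω' : Sym2 (Vtx d) → ℝ} (hω : NN d n ω) {e : Sym2 (Vtx d)} {ε δ : ℝ}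
    (hδ : 0 ≤ δ) {p : List (Vtx d)} (hp : IsPath n 0 (fun i => (n : ℤ) * v i) p)
    (ht : pathTime ω' p ≤ fppT d v n ω' + ε) (hep : e ∈ edgesOf p)
    (h : ∀ e', e' ≠ e → ω' e' = ω e') (he : ω' e = ω e + δ) :
    fppT d v n ω + δ ≤ fppT d v n ω' + ε := by
  have := fppT_le_s10 hω hp
  have h2 := sum_gain hδ h he _ hep
  rw [pathTime_eq] at *
  linarith

/-- Splicing at the middle edge `e2`. -/
lemma fppT_mid [DecidableEq (Sym2 (Vtx d))] {ω0 ω1 ω3 ω13 : Sym2 (Vtx d) → ℝ}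
    (h0 : NN d n ω0) (h13 : NN d n ω13) {e1 e2 e3 : Sym2 (Vtx d)}
    (g1 : ∀ e', e' ≠ e1 → ω1 e' = ω0 e') (g3 : ∀ e', e' ≠ e3 → ω3 e' = ω0 e')
    (g13 : ∀ e', e' ≠ e1 → e' ≠ e3 → ω13 e' = ω0 e')
    {P Q : List (Vtx d)} (hP : IsPath n 0 (fun i => (n : ℤ) * v i) P)
    (hQ : IsPath n 0 (fun i => (n : ℤ) * v i) Q) (hPn : P.Nodup)
    (p3 : e3 ∉ edgesOf P) (q1 : e1 ∉ edgesOf Q) (p2 : e2 ∈ edgesOf P) (q2 : e2 ∈ edgesOf Q)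
    (hlt : (edgesOf P).idxOf e1 < (edgesOf P).idxOf e2)
    (hlt' : (edgesOf Q).idxOf e2 < (edgesOf Q).idxOf e3) :
    fppT d v n ω13 + fppT d v n ω0 ≤ pathTime ω3 P + pathTime ω1 Q := by
  obtain ⟨x, hx⟩ : ∃ x, x ∈ e2 := ⟨_, Sym2.out_fst_mem e2⟩
  rw [pathTime_congr (ω' := ω0) (p := P) (fun x hx => g3 x (by rintro rfl; exact p3 hx)),
    pathTime_congr (ω' := ω0) (p := Q) (fun x hx => g1 x (by rintro rfl; exact q1 hx))]
  obtain ⟨L, R, rfl, hR⟩ := before_split hx P hPn p2 hlt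
  obtain ⟨L', R', rfl, hL⟩ := after_split hx Q q2 hlt'
  have hp := fppT_le_s10 h0 (isPath_splice hP hQ)
  have hq := fppT_le_s10 h13 (isPath_splice hQ hP)
  rw [pathTime_congr (ω' := ω0) (p := L' ++ x :: R)] at hq
  · have hs : ∀ A B : List (Vtx d), pathTime ω0 (A ++ x :: B)
        = ((edgesOf (A ++ [x])).map ω0).sum + ((edgesOf (x :: B)).map ω0).sum := by
      intro A B
      rw [pathTime_eq, edgesOf_split, List.map_append, List.sum_append]
    rw [hs] at hp hq ⊢
    rw [hs]
    linarith
  · rw [edgesOf_split] at p3 q1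
    rw [edgesOf_split]
    intro e he
    simp only [List.mem_append, not_or] at *
    apply g13
    · rintro rfl; tauto
    · rintro rfl; tauto

end F

/-- explicit environment on the cube -/
def cube {E : Type*} [DecidableEq E] (ω : E → ℝ) (e1 e2 e3 : E) (x y z : ℝ) : E → ℝ :=
  Function.update (Function.update (Function.update ω e1 x) e2 y) e3 z

lemma cube_bound {d : ℕ} {v : Vtx d} {n : ℕ} [DecidableEq (Sym2 (Vtx d))]
    (hne : ∃ p, IsPath n 0 (fun i => (n : ℤ) * v i) p) {a b : ℝ} (ha : 0 < a) (hab : a < b)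
    {ω : Sym2 (Vtx d) → ℝ} (hω : NN d n ω) {e1 e2 e3 : Sym2 (Vtx d)}
    (h12 : e1 ≠ e2) (h13 : e1 ≠ e3) (h23 : e2 ≠ e3) (F : ℝ → ℝ → ℝ → ℝ)
    (hF : ∀ x y z, F x y z = fppT d v n (cube ω e1 e2 e3 x y z)) :
    F b b b - F b b a - F b a b - F a b b + F b a a + F a b a + F a a b - F a a a ≥ -(b - a) := by
  have hδ : 0 ≤ b - a := by linarith
  have hb : 0 ≤ b := by linarith
  have N : ∀ x y z, 0 ≤ x → 0 ≤ y → 0 ≤ z → NN d n (cube ω e1 e2 e3 x y z) := by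
    intro x y z hx hy hz e he
    have := hω e he
    simp only [cube, Function.update_apply]
    split_ifs <;> assumption
  have D1 : ∀ x x' y z e, e ≠ e1 → cube ω e1 e2 e3 x y z e = cube ω e1 e2 e3 x' y z e := by
    intro x x' y z e he; simp [cube, Function.update_apply, he]
  have D2 : ∀ x y y' z e, e ≠ e2 → cube ω e1 e2 e3 x y z e = cube ω e1 e2 e3 x y' z e := by
    intro x x' y z e he; simp [cube, Function.update_apply, he]
  have D3 : ∀ x y z z' e, e ≠ e3 → cube ω e1 e2 e3 x y z e = cube ω e1 e2 e3 x y z' e := by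
    intro x x' y z e he; simp [cube, Function.update_apply, he]
  have V1 : ∀ x y z, cube ω e1 e2 e3 x y z e1 = x := by
    intro x y z; simp [cube, Function.update_apply, h12, h13]
  have V2 : ∀ x y z, cube ω e1 e2 e3 x y z e2 = y := by
    intro x y z; simp [cube, Function.update_apply, h23]
  have V3 : ∀ x y z, cube ω e1 e2 e3 x y z e3 = z := by
    intro x y z; simp [cube]
  have M : ∀ x x' y y' z z', 0 ≤ x → 0 ≤ y → 0 ≤ z → x ≤ x' → y ≤ y' → z ≤ z' →
      F x y z ≤ F x' y' z' := by
    intro x x' y y' z z' hx hy hz hx' hy' hz'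
    rw [hF, hF]
    refine fppT_mono hne (N x y z hx hy hz) fun e _ => ?_
    simp only [cube, Function.update_apply]
    split_ifs <;> first | assumption | exact le_rfl
  have L1 : ∀ y z, 0 ≤ y → 0 ≤ z → F b y z ≤ F a y z + (b - a) := by
    intro y z hy hz
    rw [hF, hF]
    exact fppT_lip hne (N _ _ _ ha.le hy hz) (N _ _ _ hb hy hz) hδ (D1 b a y z)
      (by rw [V1, V1]; ring)
  have L2 : ∀ y z, 0 ≤ y → 0 ≤ z → F y b z ≤ F y a z + (b - a) := by
    intro y z hy hz
    rw [hF, hF]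
    exact fppT_lip hne (N _ _ _ hy ha.le hz) (N _ _ _ hy hb hz) hδ (D2 y b a z)
      (by rw [V2, V2]; ring)
  have L3 : ∀ y z, 0 ≤ y → 0 ≤ z → F y z b ≤ F y z a + (b - a) := by
    intro y z hy hz
    rw [hF, hF]
    exact fppT_lip hne (N _ _ _ hy hz ha.le) (N _ _ _ hy hz hb) hδ (D3 y z b a)
      (by rw [V3, V3]; ring)
  have a0 := ha.le
  have ab := hab.le
  have m1 := M b b b b a b hb hb a0 le_rfl le_rfl ab
  have m2 := M b b a b b b hb a0 hb le_rfl ab le_rfl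
  have m3 := M a b b b b b a0 hb hb ab le_rfl le_rfl
  have n1 := M a b a a a a a0 a0 a0 ab le_rfl le_rfl
  have n2 := M a a a b a a a0 a0 a0 le_rfl ab le_rfl
  have n3 := M a a a a a b a0 a0 a0 le_rfl le_rfl ab
  have l1 := L1 b a hb a0
  have l2 := L1 a b a0 hb
  have l3 := L2 b a hb a0
  have l4 := L2 a b a0 hb
  have l5 := L3 b a hb a0
  have l6 := L3 a b a0 hb
  apply le_of_forall_pos_le_add
  intro ε' hε'
  obtain ⟨ε, hε, rfl⟩ : ∃ ε, 0 < ε ∧ ε' = 2 * ε := ⟨ε' / 2, by positivity, by ring⟩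
  obtain ⟨A1, p1, k1, t1⟩ := exists_near hne (N b a a hb a0 a0) hε
  obtain ⟨A2, p2, k2, t2⟩ := exists_near hne (N a b a a0 hb a0) hε
  obtain ⟨A3, p3, k3, t3⟩ := exists_near hne (N a a b a0 a0 hb) hε
  by_cases c11 : e1 ∈ edgesOf A1
  · have := fppT_gain (N a a a a0 a0 a0) hδ p1 t1 c11 (D1 _ _ _ _) (by rw [V1, V1]; ring)
    rw [← hF, ← hF] at this
    linarith
  by_cases c22 : e2 ∈ edgesOf A2
  · have := fppT_gain (N a a a a0 a0 a0) hδ p2 t2 c22 (D2 _ _ _ _) (by rw [V2, V2]; ring)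
    rw [← hF, ← hF] at this
    linarith
  by_cases c33 : e3 ∈ edgesOf A3
  · have := fppT_gain (N a a a a0 a0 a0) hδ p3 t3 c33 (D3 _ _ _ _) (by rw [V3, V3]; ring)
    rw [← hF, ← hF] at this
    linarith
  by_cases c12 : e1 ∉ edgesOf A2
  · have := fppT_avoid (N b b a hb hb a0) p2 t2 c12 (D1 _ _ _ _)
    rw [← hF, ← hF] at this
    linarith
  by_cases c13 : e1 ∉ edgesOf A3
  · have := fppT_avoid (N b a b hb a0 hb) p3 t3 c13 (D1 _ _ _ _)
    rw [← hF, ← hF] at this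
    linarith
  by_cases c21 : e2 ∉ edgesOf A1
  · have := fppT_avoid (N b b a hb hb a0) p1 t1 c21 (D2 _ _ _ _)
    rw [← hF, ← hF] at this
    linarith
  by_cases c23 : e2 ∉ edgesOf A3
  · have := fppT_avoid (N a b b a0 hb hb) p3 t3 c23 (D2 _ _ _ _)
    rw [← hF, ← hF] at this
    linarith
  by_cases c31 : e3 ∉ edgesOf A1
  · have := fppT_avoid (N b a b hb a0 hb) p1 t1 c31 (D3 _ _ _ _)
    rw [← hF, ← hF] at this
    linarith
  by_cases c32 : e3 ∉ edgesOf A2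
  · have := fppT_avoid (N a b b a0 hb hb) p2 t2 c32 (D3 _ _ _ _)
    rw [← hF, ← hF] at this
    linarith
  rw [not_not] at c12 c13 c21 c23 c31 c32
  have E12 : ∀ e, e ≠ e1 → e ≠ e2 → cube ω e1 e2 e3 b b a e = cube ω e1 e2 e3 a a a e :=
    fun e h h' => (D1 _ a _ _ e h).trans (D2 _ _ _ _ e h')
  have E13 : ∀ e, e ≠ e1 → e ≠ e3 → cube ω e1 e2 e3 b a b e = cube ω e1 e2 e3 a a a e :=
    fun e h h' => (D1 _ a _ _ e h).trans (D3 _ _ _ _ e h')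
  have E23 : ∀ e, e ≠ e2 → e ≠ e3 → cube ω e1 e2 e3 a b b e = cube ω e1 e2 e3 a a a e :=
    fun e h h' => (D2 _ _ a _ e h).trans (D3 _ _ _ _ e h')
  have N0 := N a a a a0 a0 a0
  have N12 := N b b a hb hb a0
  have N13 := N b a b hb a0 hb
  have N23 := N a b b a0 hb hb
  have G1 := D1 b a a a
  have G2 := D2 a b a a
  have G3 := D3 a a b a
  have i3 : (edgesOf A3).idxOf e1 ≠ (edgesOf A3).idxOf e2 :=
    fun h => h12 ((List.idxOf_inj c13).1 h)
  have i2 : (edgesOf A2).idxOf e1 ≠ (edgesOf A2).idxOf e3 :=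
    fun h => h13 ((List.idxOf_inj c12).1 h)
  have i1 : (edgesOf A1).idxOf e2 ≠ (edgesOf A1).idxOf e3 :=
    fun h => h23 ((List.idxOf_inj c21).1 h)
  rw [← hF] at t1 t2 t3
  rcases lt_or_gt_of_ne i3 with u3 | u3 <;> rcases lt_or_gt_of_ne i1 with u1 | u1
  · -- 1 before 2, 2 before 3
    have := fppT_mid N0 N13 G1 G3 E13 p3 p1 k3 c33 c11 c23 c21 u3 u1
    rw [← hF, ← hF] at this
    linarith
  · rcases lt_or_gt_of_ne i2 with u2 | u2
    · -- 1 before 3, 3 before 2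
      have := fppT_mid N0 N12 G1 G2 E12 p2 p1 k2 c22 c11 c32 c31 u2 u1
      rw [← hF, ← hF] at this
      linarith
    · -- 3 before 1, 1 before 2
      have := fppT_mid N0 N23 G3 G2 (fun e h h' => E23 e h' h) p2 p3 k2 c22 c33 c12 c13 u2 u3
      rw [← hF, ← hF] at this
      linarith
  · rcases lt_or_gt_of_ne i2 with u2 | u2
    · -- 2 before 1, 1 before 3
      have := fppT_mid N0 N23 G2 G3 E23 p3 p2 k3 c33 c22 c13 c12 u3 u2
      rw [← hF, ← hF] at this
      linarith
    · -- 2 before 3, 3 before 1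
      have := fppT_mid N0 N12 G2 G1 (fun e h h' => E12 e h' h) p1 p2 k1 c11 c22 c31 c32 u1 u2
      rw [← hF, ← hF] at this
      linarith
  · -- 3 before 2, 2 before 1
    have := fppT_mid N0 N13 G3 G1 (fun e h h' => E13 e h' h) p1 p3 k1 c11 c33 c21 c23 u1 u3
    rw [← hF, ← hF] at this
    linarith

/--
For every subset `S ⊆ W_n` with exactly three elements and every
environment `ω ∈ Ω_n`, the third-order environment derivative of the first-passage
percolation time satisfies `∂_S f(ω) ≥ −(b − a)`.
-/
theorem fpp_third_deriv_ge (d : ℕ) (hd : 2 ≤ d) (a b : ℝ) (ha : 0 < a) (hab : a < b)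
    (v : Vtx d) (hv : ∀ i, |v i| ≤ 2) (n : ℕ)
    (S : Finset (Sym2 (Vtx d))) (hS : ↑S ⊆ EdgeSet d n) (hcard : S.card = 3)
    (ω : Sym2 (Vtx d) → ℝ) (hω : ValidEnv d n a b ω) :
    envDerivOn a b S (fppT d v n) ω ≥ -(b - a) := by
  have hlen : S.toList.length = 3 := by rw [Finset.length_toList, hcard]
  have hnd := S.nodup_toList
  unfold envDerivOn
  generalize S.toList = l at hlen hnd
  obtain ⟨e1, e2, e3, rfl⟩ := List.length_eq_three.1 hlen
  simp only [List.foldr_cons, List.foldr_nil, envDeriv]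
  by_cases hne : ∃ p, IsPath n 0 (fun i => (n : ℤ) * v i) p
  · have hNN : NN d n ω := fun e he => by
      rcases hω e he with h | h <;> rw [h] <;> linarith
    simp only [List.nodup_cons, List.mem_cons, List.not_mem_nil, not_or, or_false] at hnd
    have := cube_bound hne ha hab hNN hnd.1.1 hnd.1.2 hnd.2.1 _ (fun x y z => rfl)
    simp only [cube] at this
    linarith
  · have h0 : ∀ ω', fppT d v n ω' = 0 := by
      intro ω'
      have : {t : ℝ | ∃ p : List (Vtx d), IsPath n 0 (fun i => (n : ℤ) * v i) p ∧
          t = pathTime ω' p} = ∅ := by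
        ext t
        simp only [Set.mem_setOf_eq, Set.mem_empty_iff_false, iff_false]
        rintro ⟨p, hp, -⟩
        exact hne ⟨p, hp⟩
      rw [fppT, this, Real.sInf_empty]
    simp only [h0]
    linarith

end
end

section
/- Let k and x be two edges in W, let K_1 and K_2 be the endpoints of k, and let ω ∈ Ω be an environment. Assume that on σ_x^a(ω) there is a geodesic λ_a that contains the edge k, and that on σ_x^b(ω) there is a geodesic λ_b that contains the edge k. Then the order in which K_1 and K_2 are traversed along λ_a (going from the source 0 to the sink nv) is the same as the order in which they are traversed along λ_b. -/
noncomputable section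

theorem pt_split {d : ℕ} (ω : Sym2 (Vtx d) → ℝ) (l₁ l₂ : List (Vtx d)) (z : Vtx d) :
    pathTime ω (l₁ ++ z :: l₂) = pathTime ω (l₁ ++ [z]) + pathTime ω (z :: l₂) := by
  induction l₁ with
  | nil => simp [pathTime]
  | cons h t ih =>
    cases t with
    | nil => simp [pathTime]
    | cons h' t' =>
      simp only [pathTime, List.cons_append, List.tail_cons, List.zip_cons_cons, List.map_cons,
        List.sum_cons] at ih ⊢
      rw [ih]; ring

theorem pt_cons {d : ℕ} (ω : Sym2 (Vtx d) → ℝ) (l : List (Vtx d)) (y z : Vtx d) :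
    pathTime ω (y :: z :: l) = ω s(y, z) + pathTime ω (z :: l) := by
  simp [pathTime]

theorem isPath_split {d : ℕ} (n : ℕ) (u w z : Vtx d) (l₁ l₂ : List (Vtx d)) :
    IsPath n u w (l₁ ++ z :: l₂) ↔ IsPath n u z (l₁ ++ [z]) ∧ IsPath n z w (z :: l₂) := by
  unfold IsPath
  have h1 : (l₁ ++ z :: l₂).head? = (l₁ ++ [z]).head? := by cases l₁ <;> simp
  have h2 : (l₁ ++ z :: l₂).getLast? = (z :: l₂).getLast? := by
    rw [List.getLast?_append, List.getLast?_eq_some_getLast (by simp : z :: l₂ ≠ [])]; rfl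
  have h3 : (l₁ ++ z :: l₂).Chain' adjV ↔
      (l₁ ++ [z]).Chain' adjV ∧ (z :: l₂).Chain' adjV := List.isChain_split
  have h4 : (l₁ ++ [z]).getLast? = some z := by simp
  rw [h1, h2, h3, h4]
  simp only [List.mem_append, List.mem_cons, List.head?_cons]
  constructor
  · rintro ⟨⟨c1, c2⟩, hh, hl, hb⟩
    exact ⟨⟨c1, hh, by trivial, fun y hy => hb y (by simp at hy; tauto)⟩,
      c2, by trivial, hl, fun y hy => hb y (by tauto)⟩
  · rintro ⟨⟨c1, hh, _, hb⟩, c2, _, hl, hb'⟩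
    exact ⟨⟨c1, c2⟩, hh, hl, fun y hy => by
      rcases hy with hy | hy
      · exact hb y (Or.inl hy)
      · exact hb' y hy⟩

theorem zip_mem_split {α : Type*} (p : List α) (y z : α) (h : (y, z) ∈ p.zip p.tail) :
    ∃ l₁ l₂, p = l₁ ++ y :: z :: l₂ := by
  induction p with
  | nil => simp at h
  | cons c t ih =>
    cases t with
    | nil => simp at h
    | cons c' t' =>
      simp only [List.tail_cons, List.zip_cons_cons, List.mem_cons, Prod.mk.injEq] at h
      rcases h with ⟨rfl, rfl⟩ | h
      · exact ⟨[], t', rfl⟩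
      · obtain ⟨l₁, l₂, e⟩ := ih h
        exact ⟨c :: l₁, l₂, by rw [e]; rfl⟩

theorem pt_nonneg {d : ℕ} (n : ℕ) (ω : Sym2 (Vtx d) → ℝ)
    (hω : ∀ e ∈ EdgeSet d n, 0 ≤ ω e) (p : List (Vtx d)) (hc : p.Chain' adjV)
    (hb : ∀ y ∈ p, inBox n y) : 0 ≤ pathTime ω p := by
  induction p with
  | nil => simp [pathTime]
  | cons c t ih =>
    cases t with
    | nil => simp [pathTime]
    | cons c' t' =>
      rw [pt_cons]
      have hc' := List.isChain_cons_cons.1 hc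
      have := ih hc'.2 (fun y hy => hb y (List.mem_cons_of_mem _ hy))
      have := hω s(c, c') ⟨c, c', rfl, hc'.1, hb c (by simp), hb c' (by simp)⟩
      linarith

theorem pt_mono {d : ℕ} (ω ω' : Sym2 (Vtx d) → ℝ) (p : List (Vtx d))
    (h : ∀ e ∈ edgesOf p, ω e ≤ ω' e) : pathTime ω p ≤ pathTime ω' p := by
  induction p with
  | nil => simp [pathTime]
  | cons c t ih =>
    cases t with
    | nil => simp [pathTime]
    | cons c' t' =>
      rw [pt_cons, pt_cons]
      have := ih (fun e he => h e (by simp [edgesOf] at he ⊢; tauto))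
      have := h s(c, c') (by simp [edgesOf])
      linarith

theorem edge_vtx {d : ℕ} (p : List (Vtx d)) (y z : Vtx d) (h : s(y, z) ∈ edgesOf p) :
    y ∈ p := by
  simp only [edgesOf, List.mem_map, Prod.exists] at h
  obtain ⟨c, c', hm, he⟩ := h
  have h1 := (List.of_mem_zip hm).1
  have h2 := List.mem_of_mem_tail (List.of_mem_zip hm).2
  rcases Sym2.eq_iff.1 he with ⟨rfl, rfl⟩ | ⟨rfl, rfl⟩ <;> assumption

theorem geo_le {d : ℕ} {v : Vtx d} {n : ℕ} {ω : Sym2 (Vtx d) → ℝ} {p q : List (Vtx d)}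
    (hω : ∀ e ∈ EdgeSet d n, 0 < ω e) (hp : IsGeodesic d v n ω p)
    (hq : IsPath n 0 (fun i => (n : ℤ) * v i) q) : pathTime ω p ≤ pathTime ω q := by
  rw [hp.2]
  apply csInf_le
  · refine ⟨0, ?_⟩
    rintro t ⟨r, hr, rfl⟩
    exact pt_nonneg n ω (fun e he => (hω e he).le) r hr.1 hr.2.2.2
  · exact ⟨q, hq, rfl⟩

theorem upd_pos {d n : ℕ} {a b c : ℝ} (ha : 0 < a) (hab : a < b) (hc : 0 < c)
    {ω : Sym2 (Vtx d) → ℝ} (hω : ValidEnv d n a b ω) (x : Sym2 (Vtx d)) :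
    ∀ e ∈ EdgeSet d n, 0 < Function.update ω x c e := by
  intro e he
  by_cases h : e = x
  · subst h; simpa using hc
  · rw [Function.update_of_ne h]
    rcases hω e he with h | h <;> rw [h] <;> linarith

theorem no_switch_aux (d : ℕ) (a b : ℝ) (ha : 0 < a)
    (hab : a < b) (v : Vtx d) (n : ℕ)
    (K₁ K₂ : Vtx d) (x : Sym2 (Vtx d))
    (hk : s(K₁, K₂) ∈ EdgeSet d n)
    (ω : Sym2 (Vtx d) → ℝ) (hω : ValidEnv d n a b ω)
    (pa pb : List (Vtx d))
    (hga : IsGeodesic d v n (Function.update ω x a) pa)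
    (hgb : IsGeodesic d v n (Function.update ω x b) pb)
    (h1 : (K₁, K₂) ∈ pa.zip pa.tail) (h2 : (K₂, K₁) ∈ pb.zip pb.tail) : False := by
  have pA := upd_pos ha hab ha hω x
  have pB := upd_pos ha hab (ha.trans hab) hω x
  have hle : ∀ e, Function.update ω x a e ≤ Function.update ω x b e := by
    intro e
    by_cases h : e = x
    · subst h; simpa using hab.le
    · simp [Function.update_of_ne h]
  have hge : ∀ p : List (Vtx d), x ∉ edgesOf p →
      pathTime (Function.update ω x b) p ≤ pathTime (Function.update ω x a) p := by
    intro p hp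
    apply pt_mono
    intro e he
    have : e ≠ x := fun h => hp (h ▸ he)
    simp [Function.update_of_ne this]
  generalize Function.update ω x a = ωa at *
  generalize Function.update ω x b = ωb at *
  obtain ⟨l₁, l₂, rfl⟩ := zip_mem_split _ _ _ h1
  obtain ⟨m₁, m₂, rfl⟩ := zip_mem_split _ _ _ h2
  have ka := pA _ hk
  have kb := pB _ hk
  obtain ⟨a1, a2⟩ := (isPath_split ..).1 hga.1
  obtain ⟨b1, b2⟩ := (isPath_split ..).1 hgb.1
  have a3 := ((isPath_split n _ _ K₂ [K₁] l₂).1 a2).2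
  have b3 := ((isPath_split n _ _ K₁ [K₂] m₂).1 b2).2
  have i1 := geo_le pA hga ((isPath_split ..).2 ⟨a1, b3⟩)
  have i2 := geo_le pA hga ((isPath_split ..).2 ⟨b1, a3⟩)
  have i3 := geo_le pB hgb ((isPath_split ..).2 ⟨a1, b3⟩)
  have i4 := geo_le pB hgb ((isPath_split ..).2 ⟨b1, a3⟩)
  rw [pt_split _ l₁ (K₂ :: l₂), pt_split _ l₁ m₂, pt_cons] at i1
  rw [pt_split, pt_split _ m₁, pt_cons] at i2
  rw [pt_split, pt_split _ l₁, pt_cons] at i3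
  rw [pt_split _ m₁ (K₁ :: m₂), pt_split _ m₁ l₂, pt_cons] at i4
  rw [Sym2.eq_swap] at i3 i4
  have j1 := pt_mono ωa ωb (m₁ ++ [K₂]) (fun e _ => hle e)
  have j2 := pt_mono ωa ωb (K₁ :: m₂) (fun e _ => hle e)
  have xA : x ∈ edgesOf (l₁ ++ [K₁]) := by
    by_contra h
    have := hge _ h
    linarith
  have xA' : x ∈ edgesOf (K₂ :: l₂) := by
    by_contra h
    have := hge _ h
    linarith
  induction x using Sym2.ind with
  | _ y z =>
  have y1 := edge_vtx _ _ _ xA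
  have y2 := edge_vtx _ _ _ xA'
  obtain ⟨s₁, s₂, e1⟩ := List.append_of_mem y1
  obtain ⟨t₁, t₂, e2⟩ := List.append_of_mem y2
  have g1 := a1
  have g2 := a3
  rw [e1] at g1
  rw [e2] at g2
  obtain ⟨c1, c2⟩ := (isPath_split ..).1 g1
  obtain ⟨c3, c4⟩ := (isPath_split ..).1 g2
  have f := geo_le pA hga ((isPath_split ..).2 ⟨c1, c4⟩)
  have nn := fun e he => (pA e he).le
  have n1 := pt_nonneg n ωa nn _ c2.1 c2.2.2.2
  have n2 := pt_nonneg n ωa nn _ c3.1 c3.2.2.2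
  rw [pt_split, pt_split _ s₁, pt_cons, e1, e2, pt_split _ s₁ s₂, pt_split _ t₁ t₂] at f
  linarith

/--
Let `k` and `x` be two edges of `W_n`, let `K₁`, `K₂` be the endpoints of
`k`, and let `ω ∈ Ω_n`.  If on `σ_x^a(ω)` there is a geodesic `pa` containing `k`, and on
`σ_x^b(ω)` there is a geodesic `pb` containing `k`, then `K₁` and `K₂` are traversed in the
same order along `pa` (from the source `0` to the sink `n • v`) as along `pb`.
(Traversing `k` from `K₁` to `K₂` means that `(K₁, K₂)` is a consecutive pair of vertices
of the path.)
-/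
theorem geodesic_direction_no_switch (d : ℕ) (hd : 2 ≤ d) (a b : ℝ) (ha : 0 < a)
    (hab : a < b) (v : Vtx d) (hv : ∀ i, |v i| ≤ 2) (n : ℕ)
    (K₁ K₂ : Vtx d) (k x : Sym2 (Vtx d)) (hkdef : k = s(K₁, K₂))
    (hk : k ∈ EdgeSet d n) (hx : x ∈ EdgeSet d n)
    (ω : Sym2 (Vtx d) → ℝ) (hω : ValidEnv d n a b ω)
    (pa pb : List (Vtx d))
    (hga : IsGeodesic d v n (Function.update ω x a) pa)
    (hgb : IsGeodesic d v n (Function.update ω x b) pb)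
    (hka : k ∈ edgesOf pa) (hkb : k ∈ edgesOf pb) :
    ((K₁, K₂) ∈ pa.zip pa.tail ↔ (K₁, K₂) ∈ pb.zip pb.tail) ∧
    ((K₂, K₁) ∈ pa.zip pa.tail ↔ (K₂, K₁) ∈ pb.zip pb.tail) := by
  subst hkdef
  have hk' : s(K₂, K₁) ∈ EdgeSet d n := by rwa [Sym2.eq_swap]
  have F1 := no_switch_aux d a b ha hab v n K₁ K₂ x hk ω hω pa pb hga hgb
  have F2 := no_switch_aux d a b ha hab v n K₂ K₁ x hk' ω hω pa pb hga hgb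
  have D : ∀ p : List (Vtx d), s(K₁, K₂) ∈ edgesOf p →
      (K₁, K₂) ∈ p.zip p.tail ∨ (K₂, K₁) ∈ p.zip p.tail := by
    intro p hp
    simp only [edgesOf, List.mem_map, Prod.exists] at hp
    obtain ⟨c, c', hm, he⟩ := hp
    rcases Sym2.eq_iff.1 he with ⟨rfl, rfl⟩ | ⟨rfl, rfl⟩
    · exact Or.inl hm
    · exact Or.inr hm
  have D1 := D pa hka
  have D2 := D pb hkb
  tauto

end
end

section
/- In dimensions d ≥ 3, for every integer m ≥ 2 the extremal values of the m-th order environment derivatives satisfy U_m ≥ C(m−2, ⌈(m−2)/2⌉) and L_m ≤ −C(m−2, ⌈(m−2)/2⌉). Equivalently, there exist n ∈ ℕ, a set S ⊆ W_n with |S| = m, and ω ∈ Ω_n with ∂_S f_n(ω) ≥ (b−a)·C(m−2, ⌈(m−2)/2⌉), and there exist n' ∈ ℕ, S' ⊆ W_{n'} with |S'| = m, and ω' ∈ Ω_{n'} with ∂_{S'} f_{n'}(ω') ≤ −(b−a)·C(m−2, ⌈(m−2)/2⌉). Here C(n,k) denotes the binomial coefficient. -/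
noncomputable section

def ReachC {d : ℕ} (n : ℕ) (ω : Sym2 (Vtx d) → ℝ) (u w : Vtx d) (c : ℝ) : Prop :=
  ∃ p, IsPath n u w p ∧ pathTime ω p = c

theorem pathTime_cons {d : ℕ} (ω : Sym2 (Vtx d) → ℝ) (x y : Vtx d) (l : List (Vtx d)) :
    pathTime ω (x :: y :: l) = ω s(x, y) + pathTime ω (y :: l) := by
  simp [pathTime]

theorem pathTime_single {d : ℕ} (ω : Sym2 (Vtx d) → ℝ) (x : Vtx d) :
    pathTime ω [x] = 0 := by
  simp [pathTime]

theorem ReachC.refl {d : ℕ} {n : ℕ} (ω : Sym2 (Vtx d) → ℝ) (u : Vtx d) (hu : inBox n u) :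
    ReachC n ω u u 0 := by
  refine ⟨[u], ⟨List.isChain_singleton u, by simp, by simp, by simpa using hu⟩, pathTime_single _ _⟩

theorem ReachC.cons {d : ℕ} {n : ℕ} {ω : Sym2 (Vtx d) → ℝ} {u y w : Vtx d} {c : ℝ}
    (h : ReachC n ω y w c) (hu : inBox n u) (ha : adjV u y) :
    ReachC n ω u w (ω s(u, y) + c) := by
  obtain ⟨p, ⟨h1, h2, h3, h4⟩, h5⟩ := h
  cases p with
  | nil => simp at h2
  | cons z l =>
    simp at h2
    subst h2
    refine ⟨u :: z :: l, ⟨?_, by simp, ?_, ?_⟩, ?_⟩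
    · exact List.IsChain.cons_cons ha h1
    · simpa using h3
    · intro x hx
      rcases List.mem_cons.1 hx with rfl | hx
      · exact hu
      · exact h4 x hx
    · rw [pathTime_cons, h5]

def cnt {d : ℕ} (i : Fin d) : List (Vtx d) → ℤ
  | x :: y :: l => |x i - y i| + cnt i (y :: l)
  | _ => 0

theorem cnt_ge {d : ℕ} (i : Fin d) (w : Vtx d) (l : List (Vtx d)) : ∀ u : Vtx d,
    (u :: l).getLast? = some w → |u i - w i| ≤ cnt i (u :: l) := by
  induction l with
  | nil => intro u h; simp at h; subst h; simp [cnt]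
  | cons y l ih =>
    intro u h
    have h2 : (y :: l).getLast? = some w := by simpa using h
    have := ih y h2
    have h3 := abs_sub_le (u i) (y i) (w i)
    simp only [cnt]
    linarith

theorem cnt_touch {d : ℕ} (i : Fin d) (w x : Vtx d) (l : List (Vtx d)) : ∀ u : Vtx d,
    (u :: l).getLast? = some w → x ∈ u :: l →
    |u i - x i| + |x i - w i| ≤ cnt i (u :: l) := by
  induction l with
  | nil =>
    intro u h hx
    simp at h hx
    subst h; subst hx; simp [cnt]
  | cons y l ih =>
    intro u h hx
    have h2 : (y :: l).getLast? = some w := by simpa using h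
    rcases List.mem_cons.1 hx with rfl | hx
    · have := cnt_ge i w (y :: l) x h
      simpa using this
    · have := ih y h2 hx
      have h3 := abs_sub_le (u i) (y i) (x i)
      simp only [cnt]
      linarith

theorem path_lower {d : ℕ} (ω : Sym2 (Vtx d) → ℝ) (a δ : ℝ) (ψ : Vtx d → ℝ) (w : Vtx d)
    (l : List (Vtx d)) : ∀ u : Vtx d, (u :: l).IsChain adjV → (u :: l).getLast? = some w →
    (∀ x ∈ u :: l, ∀ y ∈ u :: l, adjV x y → a + δ * (ψ y - ψ x) ≤ ω s(x, y)) →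
    a * ((∑ i, cnt i (u :: l) : ℤ) : ℝ) + δ * (ψ w - ψ u) ≤ pathTime ω (u :: l) := by
  induction l with
  | nil =>
    intro u _ h _
    simp at h
    subst h; simp [cnt, pathTime]
  | cons y l ih =>
    intro u hc h he
    have h2 : (y :: l).getLast? = some w := by simpa using h
    have hadj : adjV u y := (List.isChain_cons_cons.1 hc).1
    have h3 := ih y (List.isChain_cons_cons.1 hc).2 h2
      (fun x hx z hz => he x (List.mem_cons_of_mem _ hx) z (List.mem_cons_of_mem _ hz))
    have h4 := he u (by simp) y (by simp) hadj
    rw [pathTime_cons]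
    have h5 : (∑ i, cnt i (u :: y :: l)) = 1 + ∑ i, cnt i (y :: l) := by
      simp only [cnt, Finset.sum_add_distrib]
      rw [show (∑ i, |u i - y i|) = 1 from hadj]
    rw [h5]
    push_cast at h3 ⊢
    linarith

def lineV {d : ℕ} (s : Fin d → ℤ) (i1 j : Fin d) (t h : ℤ) : Vtx d :=
  fun i => if i = i1 then s i * t else if i = j then -(s i * h) else 0

def lineE {d : ℕ} (s : Fin d → ℤ) (i1 j : Fin d) (H : ℕ) (t : ℕ) : Sym2 (Vtx d) :=
  s(lineV s i1 j t H, lineV s i1 j (t + 1) H)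

def IsSlab {d : ℕ} (s : Fin d → ℤ) (i1 : Fin d) (M : ℕ) (e : Sym2 (Vtx d)) : Prop :=
  ∃ x y : Vtx d, e = s(x, y) ∧ s i1 * y i1 = s i1 * x i1 + 1 ∧ 0 ≤ s i1 * x i1 ∧
    s i1 * x i1 < M

structure GoodEnv {d : ℕ} (a b : ℝ) (s : Fin d → ℤ) (i1 i2 i3 : Fin d) (M H : ℕ)
    (ω : Sym2 (Vtx d) → ℝ) : Prop where
  g1 : ∀ e, ω e = a ∨ ω e = b
  g2 : ∀ e, ¬ IsSlab s i1 M e → ω e = a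
  g3 : ∀ e, IsSlab s i1 M e → (∀ t < M, e ≠ lineE s i1 i2 H t) →
    (∀ t < M, e ≠ lineE s i1 i3 H t) → ω e = b

theorem not_slab_of_eq {d : ℕ} {s : Fin d → ℤ} {i1 : Fin d} {M : ℕ} {x y : Vtx d}
    (h : x i1 = y i1) : ¬ IsSlab s i1 M s(x, y) := by
  rintro ⟨x', y', h1, h2, -, -⟩
  rcases Sym2.eq_iff.1 h1 with ⟨rfl, rfl⟩ | ⟨rfl, rfl⟩ <;> rw [h] at h2 <;> omega

theorem not_slab_of_ge {d : ℕ} {s : Fin d → ℤ} {i1 : Fin d} {M : ℕ} {x y : Vtx d}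
    (h : (M : ℤ) ≤ s i1 * x i1) (h' : (M : ℤ) ≤ s i1 * y i1) : ¬ IsSlab s i1 M s(x, y) := by
  rintro ⟨x', y', h1, h2, -, h3⟩
  rcases Sym2.eq_iff.1 h1 with ⟨rfl, rfl⟩ | ⟨rfl, rfl⟩ <;> omega

theorem adj_update {d : ℕ} (u : Vtx d) (i : Fin d) (z : ℤ) (hz : |u i - z| = 1) :
    adjV u (Function.update u i z) := by
  unfold adjV
  rw [Finset.sum_eq_single i]
  · simpa using hz
  · intro k _ hk; simp [hk]
  · simp

theorem reach_mono {d : ℕ} {n : ℕ} {ω : Sym2 (Vtx d) → ℝ} {a b : ℝ} {s : Fin d → ℤ}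
    {i1 i2 i3 : Fin d} {M H : ℕ} (hω : GoodEnv a b s i1 i2 i3 M H ω)
    (hs : ∀ i, s i = 1 ∨ s i = -1)
    (w : Vtx d) (hw : inBox n w) (hwM : (M : ℤ) ≤ s i1 * w i1) (N : ℕ) : ∀ u : Vtx d,
    (∑ i, |u i - w i|) = (N : ℤ) → inBox n u → (M : ℤ) ≤ s i1 * u i1 →
    ReachC n ω u w (N * a) := by
  induction N with
  | zero =>
    intro u h hu _
    have : u = w := by
      funext i
      have := (Finset.sum_eq_zero_iff_of_nonneg (fun i _ => abs_nonneg (u i - w i))).1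
        (by simpa using h) i (Finset.mem_univ i)
      have := abs_eq_zero.1 this
      omega
    subst this
    simpa using ReachC.refl ω u hu
  | succ N ih =>
    intro u h hu huM
    obtain ⟨i, hi⟩ : ∃ i, u i ≠ w i := by
      by_contra hc
      push Not at hc
      have : (∑ i, |u i - w i|) = 0 := Finset.sum_eq_zero (fun i _ => by simp [hc i])
      rw [this] at h
      push_cast at h; omega
    obtain ⟨z, hz1, hz2, hz3⟩ : ∃ z : ℤ, |u i - z| = 1 ∧ |z - w i| = |u i - w i| - 1 ∧
        ((u i ≤ z ∧ z ≤ w i) ∨ (w i ≤ z ∧ z ≤ u i)) := by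
      rcases lt_or_gt_of_ne hi with hlt | hlt
      · refine ⟨u i + 1, by simp, ?_, by omega⟩
        rw [abs_of_nonpos (by omega), abs_of_nonpos (by omega)]; ring
      · refine ⟨u i - 1, by simp, ?_, by omega⟩
        rw [abs_of_nonneg (by omega), abs_of_nonneg (by omega)]; ring
    have hbox : inBox n (Function.update u i z) := by
      intro k
      by_cases hk : k = i
      · subst hk
        have h1 := abs_le.1 (hu k)
        have h2 := abs_le.1 (hw k)
        simp only [Function.update_self]
        rw [abs_le]; omega
      · simpa [hk] using hu k
    have hM' : (M : ℤ) ≤ s i1 * Function.update u i z i1 := by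
      by_cases hk : i1 = i
      · subst hk
        simp only [Function.update_self]
        rcases hs i1 with h1 | h1 <;> rw [h1] at hwM huM ⊢ <;> omega
      · simpa [hk] using huM
    have hsum : (∑ k, |Function.update u i z k - w k|) = (N : ℤ) := by
      have e1 := Finset.add_sum_erase Finset.univ (fun k => |u k - w k|) (Finset.mem_univ i)
      have e2 := Finset.add_sum_erase Finset.univ (fun k => |Function.update u i z k - w k|)
        (Finset.mem_univ i)
      have e3 : ∑ k ∈ Finset.univ.erase i, |Function.update u i z k - w k| =
          ∑ k ∈ Finset.univ.erase i, |u k - w k| := by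
        apply Finset.sum_congr rfl
        intro k hk
        simp [Finset.ne_of_mem_erase hk]
      simp only [Function.update_self] at e2
      push_cast at h
      omega
    have := (ih _ hsum hbox hM').cons hu (adj_update u i z hz1)
    rw [hω.g2 _ (not_slab_of_ge huM hM')] at this
    convert this using 1
    push_cast; ring

theorem lineV_adj_t {d : ℕ} {s : Fin d → ℤ} (hs : ∀ i, s i = 1 ∨ s i = -1) {i1 j : Fin d}
    (t h : ℤ) : adjV (lineV s i1 j t h) (lineV s i1 j (t + 1) h) := by
  unfold adjV
  rw [Finset.sum_eq_single i1]
  · rcases hs i1 with h1 | h1 <;> simp [lineV, h1]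
  · intro k _ hk; simp [lineV, hk]
  · simp

theorem lineV_adj_h {d : ℕ} {s : Fin d → ℤ} (hs : ∀ i, s i = 1 ∨ s i = -1) {i1 j : Fin d}
    (hj : j ≠ i1) (t h : ℤ) : adjV (lineV s i1 j t h) (lineV s i1 j t (h + 1)) := by
  unfold adjV
  rw [Finset.sum_eq_single j]
  · rcases hs j with h1 | h1 <;> simp [lineV, h1, hj]
  · intro k _ hk; simp [lineV, hk]
  · simp

theorem lineV_inBox {d : ℕ} {s : Fin d → ℤ} (hs : ∀ i, s i = 1 ∨ s i = -1) {i1 j : Fin d}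
    {t h : ℤ} {n : ℕ} (ht : 0 ≤ t) (ht' : t ≤ 2 * n) (hh : 0 ≤ h) (hh' : h ≤ 2 * n) :
    inBox n (lineV s i1 j t h) := by
  intro i
  unfold lineV
  split_ifs
  · rcases hs i with h1 | h1 <;> rw [h1, abs_le] <;> omega
  · rcases hs i with h1 | h1 <;> rw [h1, abs_le] <;> omega
  · simp

theorem s_mul_s {d : ℕ} {s : Fin d → ℤ} (hs : ∀ i, s i = 1 ∨ s i = -1) (i : Fin d) (t : ℤ) :
    s i * (s i * t) = t := by
  rcases hs i with h1 | h1 <;> rw [h1] <;> ring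

theorem lineV_fst {d : ℕ} {s : Fin d → ℤ} (hs : ∀ i, s i = 1 ∨ s i = -1) {i1 j : Fin d}
    (t h : ℤ) : s i1 * lineV s i1 j t h i1 = t := by
  simp only [lineV, if_true]
  exact s_mul_s hs i1 t

theorem lineE_slab {d : ℕ} {s : Fin d → ℤ} (hs : ∀ i, s i = 1 ∨ s i = -1) {i1 j : Fin d}
    {H M t : ℕ} (ht : t < M) : IsSlab s i1 M (lineE s i1 j H t) := by
  refine ⟨_, _, rfl, ?_, ?_, ?_⟩ <;> simp only [lineV_fst hs] <;> omega

theorem lineE_edge {d : ℕ} {s : Fin d → ℤ} (hs : ∀ i, s i = 1 ∨ s i = -1) {i1 j : Fin d}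
    {H t n : ℕ} (hn : t < 2 * n) (hH : H ≤ 2 * n) : lineE s i1 j H t ∈ EdgeSet d n := by
  refine ⟨_, _, rfl, lineV_adj_t hs _ _, lineV_inBox hs ?_ ?_ ?_ ?_,
    lineV_inBox hs ?_ ?_ ?_ ?_⟩ <;> omega

theorem lineE_inj {d : ℕ} {s : Fin d → ℤ} (hs : ∀ i, s i = 1 ∨ s i = -1) {i1 j j' : Fin d}
    {H t t' : ℕ} (h : lineE s i1 j H t = lineE s i1 j' H t') :
    t = t' := by
  rcases Sym2.eq_iff.1 h with ⟨h1, h2⟩ | ⟨h1, h2⟩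
  · have := congrArg (fun x => s i1 * x i1) h1
    simp only [lineV_fst hs] at this
    omega
  · have h1 := congrArg (fun x => s i1 * x i1) h1
    have h2 := congrArg (fun x => s i1 * x i1) h2
    simp only [lineV_fst hs] at h1 h2
    omega

theorem lineE_ne {d : ℕ} {s : Fin d → ℤ} (hs : ∀ i, s i = 1 ∨ s i = -1) {i1 j j' : Fin d}
    {H t t' : ℕ} (hH : 0 < H) (hj : j ≠ i1) (hjj : j ≠ j') :
    lineE s i1 j H t ≠ lineE s i1 j' H t' := by
  intro h
  have : lineV s i1 j t H ∈ lineE s i1 j' H t' := by rw [← h]; simp [lineE]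
  rcases Sym2.mem_iff.1 this with h | h
  all_goals
    have := congrFun h j
    simp only [lineV, hj, hjj, if_true, if_false] at this
    rcases hs j with h1 | h1 <;> rw [h1] at this <;> omega

theorem reach_line {d : ℕ} {n : ℕ} {ω : Sym2 (Vtx d) → ℝ} {a b : ℝ} {s : Fin d → ℤ}
    {i1 i2 i3 : Fin d} {M H : ℕ} (hω : GoodEnv a b s i1 i2 i3 M H ω)
    (hs : ∀ i, s i = 1 ∨ s i = -1) (j : Fin d) (hj : j ≠ i1)
    (hn : M ≤ 2 * n) (hH : H ≤ 2 * n)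
    (w : Vtx d) (hw : inBox n w) (hwM : (M : ℤ) ≤ s i1 * w i1)
    (hsw : ∀ i, s i * w i = |w i|) :
    ReachC n ω 0 w (((∑ i, |w i| : ℤ) + 2 * H : ℝ) * a +
      ∑ t ∈ Finset.range M, (ω (lineE s i1 j H t) - a)) := by
  have hsum : (∑ i, |lineV s i1 j M H i - w i|) = (∑ i, |w i|) - M + H := by
    have : ∀ i, |lineV s i1 j M H i - w i| = |w i| + (if i = i1 then -(M : ℤ) else 0) +
        (if i = j then (H : ℤ) else 0) := by
      intro i
      have h2 := hsw i
      have h3 := abs_nonneg (w i)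
      unfold lineV
      by_cases h : i = i1
      · subst h
        simp only [if_true, Ne.symm hj, if_false]
        rcases hs i with h1 | h1 <;> rw [h1] at h2 hwM ⊢
        · rw [abs_of_nonpos (by omega)]; omega
        · rw [abs_of_nonneg (by omega)]; omega
      · by_cases h' : i = j
        · subst h'
          simp only [h, if_false, if_true]
          rcases hs i with h1 | h1 <;> rw [h1] at h2 ⊢
          · rw [abs_of_nonpos (by omega)]; omega
          · rw [abs_of_nonneg (by omega)]; omega
        · simp [h, h']
    simp only [this, Finset.sum_add_distrib, Finset.sum_ite_eq', Finset.mem_univ, if_true]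
    ring
  obtain ⟨N, hN⟩ : ∃ N : ℕ, (∑ i, |lineV s i1 j M H i - w i|) = (N : ℤ) :=
    Int.eq_ofNat_of_zero_le (Finset.sum_nonneg (fun i _ => abs_nonneg _))
  have r1 := reach_mono hω hs w hw hwM N (lineV s i1 j M H) hN
    (lineV_inBox hs (by omega) (by omega) (by omega) (by omega)) (by rw [lineV_fst hs])
  have r2 : ∀ k t : ℕ, t + k = M → ReachC n ω (lineV s i1 j t H) w
      (∑ x ∈ Finset.Ico t M, ω (lineE s i1 j H x) + N * a) := by
    intro k
    induction k with
    | zero => intro t ht; obtain rfl : t = M := ht; simpa using r1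
    | succ k ih =>
      intro t ht
      have := (ih (t + 1) (by omega))
      push_cast at this
      have := this.cons (u := lineV s i1 j t H)
        (lineV_inBox hs (by omega) (by omega) (by omega) (by omega)) (lineV_adj_t hs _ _)
      rw [Finset.sum_eq_sum_Ico_succ_bot (by omega : t < M), add_assoc]
      exact this
  have r2' := r2 M 0 (by omega)
  rw [← Finset.range_eq_Ico] at r2'
  set c := ∑ x ∈ Finset.range M, ω (lineE s i1 j H x) + N * a with hc
  have r3 : ∀ k h : ℕ, h + k = H → ReachC n ω (lineV s i1 j (0 : ℕ) h) w (k * a + c) := by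
    intro k
    induction k with
    | zero => intro h hh; obtain rfl : h = H := hh; simpa using r2'
    | succ k ih =>
      intro h hh
      have := (ih (h + 1) (by omega))
      push_cast at this
      have := this.cons (u := lineV s i1 j (0 : ℕ) h)
        (lineV_inBox hs (by omega) (by omega) (by omega) (by omega)) (lineV_adj_h hs hj _ _)
      rw [hω.g2 _ (not_slab_of_eq (by simp [lineV]))] at this
      convert this using 1
      push_cast; ring
  have r3' := r3 H 0 (by omega)
  have h0 : lineV s i1 j (0 : ℕ) (0 : ℕ) = 0 := by
    funext i; simp [lineV]
  rw [h0] at r3'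
  convert r3' using 1
  have hNr : (N : ℝ) = ((∑ i, |w i| : ℤ) : ℝ) - M + H := by
    rw [hsum] at hN
    exact_mod_cast hN.symm
  rw [hc, hNr, Finset.sum_sub_distrib]
  simp
  ring

theorem sum_eq_count {d : ℕ} {ω : Sym2 (Vtx d) → ℝ} {a b : ℝ}
    (g1 : ∀ e, ω e = a ∨ ω e = b) (hab : a < b) (E : ℕ → Sym2 (Vtx d)) (M : ℕ) :
    ∑ t ∈ Finset.range M, (ω (E t) - a) =
      (b - a) * (((Finset.range M).filter (fun t => ω (E t) = b)).card : ℝ) := by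
  rw [Finset.card_filter]
  push_cast
  rw [Finset.mul_sum]
  apply Finset.sum_congr rfl
  intro t _
  rcases g1 (E t) with h | h
  · rw [if_neg (by rw [h]; exact hab.ne), h]; ring
  · rw [if_pos h, h]; ring

def psi {d : ℕ} (s : Fin d → ℤ) (i1 : Fin d) (B : Finset ℕ) (x : Vtx d) : ℝ :=
  ((B.filter (fun t : ℕ => (t : ℤ) < s i1 * x i1)).card : ℝ)

theorem adj_cases {d : ℕ} {s : Fin d → ℤ} (hs : ∀ i, s i = 1 ∨ s i = -1) {i1 : Fin d}
    {x y : Vtx d} (h : adjV x y) (hlt : s i1 * x i1 < s i1 * y i1) :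
    s i1 * y i1 = s i1 * x i1 + 1 ∧ ∀ i, i ≠ i1 → x i = y i := by
  unfold adjV at h
  have e1 := Finset.add_sum_erase Finset.univ (fun k => |x k - y k|) (Finset.mem_univ i1)
  have hnn : 0 ≤ ∑ k ∈ Finset.univ.erase i1, |x k - y k| :=
    Finset.sum_nonneg (fun i _ => abs_nonneg _)
  have h1 : |x i1 - y i1| = s i1 * y i1 - s i1 * x i1 := by
    rcases hs i1 with h1 | h1 <;> rw [h1] at hlt ⊢
    · rw [abs_of_nonpos (by omega)]; ring
    · rw [abs_of_nonneg (by omega)]; ring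
  have h2 : s i1 * y i1 - s i1 * x i1 = 1 := by
    omega
  refine ⟨by omega, ?_⟩
  intro i hi
  have h0 : ∑ k ∈ Finset.univ.erase i1, |x k - y k| = 0 := by
    omega
  have := (Finset.sum_eq_zero_iff_of_nonneg (fun i _ => abs_nonneg (x i - y i))).1 h0 i
    (Finset.mem_erase.2 ⟨hi, Finset.mem_univ i⟩)
  have := abs_eq_zero.1 this
  omega

theorem edge_ineq {d : ℕ} {ω : Sym2 (Vtx d) → ℝ} {a b : ℝ} (hab : a < b)
    (g1 : ∀ e, ω e = a ∨ ω e = b) {s : Fin d → ℤ}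
    (hs : ∀ i, s i = 1 ∨ s i = -1) {i1 : Fin d} (B : Finset ℕ) {x y : Vtx d}
    (h : adjV x y)
    (hB : ∀ t ∈ B, s i1 * x i1 = t → s i1 * y i1 = t + 1 → (∀ i, i ≠ i1 → x i = y i) →
      ω s(x, y) = b) :
    a + (b - a) * (psi s i1 B y - psi s i1 B x) ≤ ω s(x, y) := by
  have hwa : a ≤ ω s(x, y) := by rcases g1 s(x, y) with h | h <;> rw [h]; exact hab.le
  have hba : 0 < b - a := by linarith
  rcases le_or_gt (s i1 * y i1) (s i1 * x i1) with hle | hlt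
  · have : psi s i1 B y ≤ psi s i1 B x := by
      unfold psi
      exact_mod_cast Finset.card_le_card (Finset.monotone_filter_right B (fun t _ ht => by
        omega))
    nlinarith
  · obtain ⟨h1, h2⟩ := adj_cases hs h hlt
    by_cases ht : ∃ t ∈ B, s i1 * x i1 = (t : ℤ)
    · obtain ⟨t, htB, ht⟩ := ht
      have hb := hB t htB ht (by omega) h2
      have : psi s i1 B y ≤ psi s i1 B x + 1 := by
        unfold psi
        have : B.filter (fun t : ℕ => (t : ℤ) < s i1 * y i1) ⊆
            insert t (B.filter (fun t : ℕ => (t : ℤ) < s i1 * x i1)) := by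
          intro t' ht'
          simp only [Finset.mem_filter, Finset.mem_insert] at ht' ⊢
          by_cases hh : t' = t
          · exact Or.inl hh
          · exact Or.inr ⟨ht'.1, by omega⟩
        have := (Finset.card_le_card this).trans (Finset.card_insert_le _ _)
        exact_mod_cast this
      rw [hb]
      nlinarith
    · have : psi s i1 B y = psi s i1 B x := by
        unfold psi
        congr 2
        apply Finset.filter_congr
        intro t htB
        have : s i1 * x i1 ≠ t := fun hh => ht ⟨t, htB, hh⟩
        omega
      rw [this]; simpa using hwa

theorem lower_B {d : ℕ} {n : ℕ} {ω : Sym2 (Vtx d) → ℝ} {a b : ℝ} (hab : a < b)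
    (g1 : ∀ e, ω e = a ∨ ω e = b) {s : Fin d → ℤ}
    (hs : ∀ i, s i = 1 ∨ s i = -1) {i1 : Fin d} {M : ℕ} (w : Vtx d)
    (hwM : (M : ℤ) ≤ s i1 * w i1) (B : Finset ℕ) (hBM : B ⊆ Finset.range M)
    (p : List (Vtx d)) (hp : IsPath n 0 w p)
    (hB : ∀ x ∈ p, ∀ y ∈ p, ∀ t ∈ B, s i1 * x i1 = t → s i1 * y i1 = t + 1 →
      (∀ i, i ≠ i1 → x i = y i) → ω s(x, y) = b) :
    a * ((∑ i, cnt i p : ℤ) : ℝ) + (b - a) * (B.card : ℝ) ≤ pathTime ω p := by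
  obtain ⟨h1, h2, h3, h4⟩ := hp
  cases p with
  | nil => simp at h2
  | cons u l =>
    simp only [List.head?_cons, Option.some.injEq] at h2
    subst h2
    have := path_lower ω a (b - a) (psi s i1 B) w l 0 h1 h3
      (fun x hx y hy hxy => edge_ineq hab g1 hs B hxy (hB x hx y hy))
    have e1 : psi s i1 B w = B.card := by
      unfold psi
      rw [Finset.filter_true_of_mem]
      intro t ht
      have := Finset.mem_range.1 (hBM ht)
      omega
    have e2 : psi s i1 B 0 = 0 := by
      unfold psi
      rw [Finset.filter_false_of_mem]
      · simp
      intro t ht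
      simp
    rw [e1, e2, sub_zero] at this
    exact this

theorem cnt_ge' {d : ℕ} {n : ℕ} (w : Vtx d) (p : List (Vtx d)) (hp : IsPath n 0 w p)
    (i : Fin d) : |w i| ≤ cnt i p := by
  obtain ⟨h1, h2, h3, h4⟩ := hp
  cases p with
  | nil => simp at h2
  | cons u l =>
    simp only [List.head?_cons, Option.some.injEq] at h2
    subst h2
    simpa using cnt_ge i w l 0 h3

theorem cnt_touch' {d : ℕ} {n : ℕ} {s : Fin d → ℤ}
    (hs : ∀ i, s i = 1 ∨ s i = -1) (w : Vtx d) (p : List (Vtx d)) (hp : IsPath n 0 w p)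
    (hsw : ∀ i, s i * w i = |w i|) (H : ℕ)
    (i : Fin d) (ht : ∃ x ∈ p, x i = -(s i * H)) : |w i| + 2 * H ≤ cnt i p := by
  obtain ⟨h1, h2, h3, h4⟩ := hp
  obtain ⟨x, hx, hxi⟩ := ht
  cases p with
  | nil => simp at h2
  | cons u l =>
    simp only [List.head?_cons, Option.some.injEq] at h2
    subst h2
    have := cnt_touch i w x l 0 h3 hx
    refine le_trans ?_ this
    have h5 := hsw i
    have h6 := abs_nonneg (w i)
    rw [hxi, Pi.zero_apply]
    rcases hs i with h | h <;> rw [h] at h5 ⊢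
    · rw [abs_of_nonneg (a := 0 - -(1 * (H : ℤ))) (by omega),
        abs_of_nonpos (a := -(1 * (H : ℤ)) - w i) (by omega)]; omega
    · rw [abs_of_nonpos (a := 0 - -(-1 * (H : ℤ))) (by omega),
        abs_of_nonneg (a := -(-1 * (H : ℤ)) - w i) (by omega)]; omega

theorem cnt_sum {d : ℕ} (w : Vtx d) (p : List (Vtx d)) (i2 i3 : Fin d) (h23 : i2 ≠ i3)
    (A2 A3 : ℤ) (h : ∀ i, |w i| ≤ cnt i p) (h2 : |w i2| + A2 ≤ cnt i2 p)
    (h3 : |w i3| + A3 ≤ cnt i3 p) : (∑ i, |w i|) + A2 + A3 ≤ ∑ i, cnt i p := by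
  have : (∑ i, |w i|) + A2 + A3 =
      ∑ i, (|w i| + (if i = i2 then A2 else 0) + (if i = i3 then A3 else 0)) := by
    simp [Finset.sum_add_distrib]
  rw [this]
  apply Finset.sum_le_sum
  intro i _
  by_cases e2 : i = i2
  · subst e2; simpa [h23] using h2
  · by_cases e3 : i = i3
    · subst e3; simpa [e2] using h3
    · simpa [e2, e3] using h i

theorem ne_lineE {d : ℕ} {s : Fin d → ℤ} {i1 j : Fin d} (hj : j ≠ i1) {H t : ℕ} {x y : Vtx d}
    (hx : x j ≠ -(s j * H)) : s(x, y) ≠ lineE s i1 j H t := by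
  intro h
  have : x ∈ lineE s i1 j H t := by rw [← h]; simp
  rcases Sym2.mem_iff.1 this with h | h <;> exact hx (by rw [h]; simp [lineV, hj])

theorem fpp_lower {d : ℕ} {n : ℕ} {ω : Sym2 (Vtx d) → ℝ} {a b : ℝ} (ha : 0 < a) (hab : a < b)
    {s : Fin d → ℤ}
    {i1 i2 i3 : Fin d} {M H K : ℕ} (hω : GoodEnv a b s i1 i2 i3 M H ω)
    (hs : ∀ i, s i = 1 ∨ s i = -1) (h2 : i2 ≠ i1) (h3 : i3 ≠ i1) (h23 : i2 ≠ i3)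
    (w : Vtx d) (hwM : (M : ℤ) ≤ s i1 * w i1)
    (hsw : ∀ i, s i * w i = |w i|)
    (hK1 : K * (b - a) ≤ 2 * H * a) (hK2 : 2 * H * a + K * (b - a) ≤ M * (b - a))
    (c2 c3 : ℕ)
    (hc2 : ((Finset.range M).filter (fun t => ω (lineE s i1 i2 H t) = b)).card = c2)
    (hc3 : ((Finset.range M).filter (fun t => ω (lineE s i1 i3 H t) = b)).card = c3)
    (hK : min c2 c3 ≤ K)
    (p : List (Vtx d)) (hp : IsPath n 0 w p) :
    ((∑ i, |w i| : ℤ) + 2 * H : ℝ) * a + (b - a) * ((min c2 c3 : ℕ) : ℝ) ≤ pathTime ω p := by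
  have hba : 0 < b - a := by linarith
  have hKr : ((min c2 c3 : ℕ) : ℝ) ≤ K := by exact_mod_cast hK
  have hm2 : ((min c2 c3 : ℕ) : ℝ) ≤ c2 := by exact_mod_cast min_le_left _ _
  have hm3 : ((min c2 c3 : ℕ) : ℝ) ≤ c3 := by exact_mod_cast min_le_right _ _
  have hmK := mul_le_mul_of_nonneg_left hKr hba.le
  have hmm2 := mul_le_mul_of_nonneg_left hm2 hba.le
  have hmm3 := mul_le_mul_of_nonneg_left hm3 hba.le
  have hslab : ∀ (x y : Vtx d) (t : ℕ), t < M → s i1 * x i1 = t → s i1 * y i1 = t + 1 →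
      IsSlab s i1 M s(x, y) := fun x y t ht e1 e2 => ⟨x, y, rfl, by omega, by omega, by omega⟩
  -- an edge of the slab equal to a line edge
  have key : ∀ (j : Fin d) (x y : Vtx d) (t t' : ℕ), s i1 * x i1 = t → s i1 * y i1 = t + 1 →
      s(x, y) = lineE s i1 j H t' → t = t' := by
    intro j x y t t' e1 e2 h
    rcases Sym2.eq_iff.1 h with ⟨q1, q2⟩ | ⟨q1, q2⟩
    · rw [q1, lineV_fst hs] at e1; omega
    · rw [q1, lineV_fst hs] at e1; rw [q2, lineV_fst hs] at e2; omega
  have tp : ∀ A : ℤ, A ≤ ∑ i, cnt i p → a * (A : ℝ) ≤ a * ((∑ i, cnt i p : ℤ) : ℝ) :=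
    fun A hA => mul_le_mul_of_nonneg_left (by exact_mod_cast hA) ha.le
  have g := cnt_ge' w p hp
  by_cases t2 : ∃ x ∈ p, x i2 = -(s i2 * H) <;> by_cases t3 : ∃ x ∈ p, x i3 = -(s i3 * H)
  · have l := lower_B hab hω.g1 hs w hwM ∅ (by simp) p hp (by simp)
    have := tp _ (cnt_sum w p i2 i3 h23 _ _ g (cnt_touch' hs w p hp hsw H i2 t2)
      (cnt_touch' hs w p hp hsw H i3 t3))
    push_cast at this l
    simp only [Finset.card_empty, Nat.cast_zero, mul_zero] at l
    push_cast
    push_cast at hmK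
    nlinarith
  · have l := lower_B hab hω.g1 hs w hwM
      ((Finset.range M).filter (fun t => ω (lineE s i1 i2 H t) = b)) (Finset.filter_subset _ _)
      p hp (by
        intro x hx y hy t ht e1 e2 _
        rw [Finset.mem_filter, Finset.mem_range] at ht
        by_cases hh : ∃ t' < M, s(x, y) = lineE s i1 i2 H t'
        · obtain ⟨t', _, ht'⟩ := hh
          have := key i2 x y t t' e1 e2 ht'
          subst this
          rw [ht']; exact ht.2
        · push Not at hh
          exact hω.g3 _ (hslab x y t ht.1 e1 e2) hh
            (fun t' _ => ne_lineE h3 (fun hc => t3 ⟨x, hx, hc⟩)))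
    have := tp _ (cnt_sum w p i2 i3 h23 _ 0 g (cnt_touch' hs w p hp hsw H i2 t2)
      (by simpa using g i3))
    rw [hc2] at l
    push_cast at this l
    push_cast
    push_cast at hmm2
    nlinarith
  · have l := lower_B hab hω.g1 hs w hwM
      ((Finset.range M).filter (fun t => ω (lineE s i1 i3 H t) = b)) (Finset.filter_subset _ _)
      p hp (by
        intro x hx y hy t ht e1 e2 _
        rw [Finset.mem_filter, Finset.mem_range] at ht
        by_cases hh : ∃ t' < M, s(x, y) = lineE s i1 i3 H t'
        · obtain ⟨t', _, ht'⟩ := hh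
          have := key i3 x y t t' e1 e2 ht'
          subst this
          rw [ht']; exact ht.2
        · push Not at hh
          exact hω.g3 _ (hslab x y t ht.1 e1 e2)
            (fun t' _ => ne_lineE h2 (fun hc => t2 ⟨x, hx, hc⟩)) hh)
    have := tp _ (cnt_sum w p i2 i3 h23 0 _ g (by simpa using g i2)
      (cnt_touch' hs w p hp hsw H i3 t3))
    rw [hc3] at l
    push_cast at this l
    push_cast
    push_cast at hmm3
    nlinarith
  · have l := lower_B hab hω.g1 hs w hwM (Finset.range M) subset_rfl
      p hp (by
        intro x hx y hy t ht e1 e2 _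
        rw [Finset.mem_range] at ht
        exact hω.g3 _ (hslab x y t ht e1 e2)
            (fun t' _ => ne_lineE h2 (fun hc => t2 ⟨x, hx, hc⟩))
            (fun t' _ => ne_lineE h3 (fun hc => t3 ⟨x, hx, hc⟩)))
    have := tp _ (cnt_sum w p i2 i3 h23 0 0 g (by simpa using g i2) (by simpa using g i3))
    rw [Finset.card_range] at l
    push_cast at this l
    push_cast
    push_cast at hmK
    nlinarith

theorem fpp_value {d : ℕ} {n : ℕ} {ω : Sym2 (Vtx d) → ℝ} {a b : ℝ} (ha : 0 < a) (hab : a < b)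
    {s : Fin d → ℤ}
    {i1 i2 i3 : Fin d} {M H K : ℕ} (hω : GoodEnv a b s i1 i2 i3 M H ω)
    (hs : ∀ i, s i = 1 ∨ s i = -1) (h2 : i2 ≠ i1) (h3 : i3 ≠ i1) (h23 : i2 ≠ i3)
    (hn : M ≤ 2 * n) (hH : H ≤ 2 * n)
    (v w : Vtx d) (hvw : w = fun i => (n : ℤ) * v i) (hw : inBox n w)
    (hwM : (M : ℤ) ≤ s i1 * w i1)
    (hsw : ∀ i, s i * w i = |w i|)
    (hK1 : K * (b - a) ≤ 2 * H * a) (hK2 : 2 * H * a + K * (b - a) ≤ M * (b - a))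
    (c2 c3 : ℕ)
    (hc2 : ((Finset.range M).filter (fun t => ω (lineE s i1 i2 H t) = b)).card = c2)
    (hc3 : ((Finset.range M).filter (fun t => ω (lineE s i1 i3 H t) = b)).card = c3)
    (hK : min c2 c3 ≤ K) :
    fppT d v n ω =
      ((∑ i, |w i| : ℤ) + 2 * H : ℝ) * a + (b - a) * ((min c2 c3 : ℕ) : ℝ) := by
  have low := fpp_lower (n := n) ha hab hω hs h2 h3 h23 w hwM hsw hK1 hK2 c2 c3 hc2 hc3 hK
  have r2 := reach_line hω hs i2 h2 hn hH w hw hwM hsw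
  have r3 := reach_line hω hs i3 h3 hn hH w hw hwM hsw
  rw [sum_eq_count hω.g1 hab, hc2] at r2
  rw [sum_eq_count hω.g1 hab, hc3] at r3
  unfold fppT
  rw [← hvw]
  have : IsLeast {t : ℝ | ∃ p : List (Vtx d), IsPath n 0 w p ∧ t = pathTime ω p}
      (((∑ i, |w i| : ℤ) + 2 * H : ℝ) * a + (b - a) * ((min c2 c3 : ℕ) : ℝ)) := by
    constructor
    · rcases le_total c2 c3 with h | h
      · rw [min_eq_left h]
        obtain ⟨p, hp, hpt⟩ := r2
        exact ⟨p, hp, hpt.symm⟩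
      · rw [min_eq_right h]
        obtain ⟨p, hp, hpt⟩ := r3
        exact ⟨p, hp, hpt.symm⟩
    · rintro t ⟨p, hp, rfl⟩
      exact low p hp
  exact this.csInf_eq

def D1 (F : ℕ → ℕ → ℝ) : ℕ → ℕ → ℝ := fun i j => F (i + 1) j - F i j
def D2 (F : ℕ → ℕ → ℝ) : ℕ → ℕ → ℝ := fun i j => F i (j + 1) - F i j

theorem D2_D1_iter (k : ℕ) (F : ℕ → ℕ → ℝ) : D2 (D1^[k] F) = D1^[k] (D2 F) := by
  have : Function.Commute D2 D1 := by
    intro F; funext i j; simp only [D1, D2]; ring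
  exact (this.iterate_right k) F

def NB {E : Type*} (b : ℝ) (S : Finset E) (ω : E → ℝ) : ℕ := (S.filter (fun e => ω e = b)).card

theorem NB_update_notMem {E : Type*} [DecidableEq E] (b x : ℝ) (S : Finset E) (ω : E → ℝ) (j : E)
    (hj : j ∉ S) : NB b S (Function.update ω j x) = NB b S ω := by
  unfold NB
  congr 1
  apply Finset.filter_congr
  intro e he
  have hne : e ≠ j := fun h => hj (h ▸ he)
  rw [Function.update_of_ne hne]

theorem NB_insert_b {E : Type*} [DecidableEq E] (b : ℝ) (S : Finset E) (ω : E → ℝ) (j : E)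
    (hj : j ∉ S) : NB b (insert j S) (Function.update ω j b) = NB b S ω + 1 := by
  rw [← NB_update_notMem b b S ω j hj]
  unfold NB
  rw [Finset.filter_insert, if_pos (by simp), Finset.card_insert_of_notMem]
  simp [hj]

theorem NB_insert_a {E : Type*} [DecidableEq E] (a b : ℝ) (hab : a < b) (S : Finset E)
    (ω : E → ℝ) (j : E)
    (hj : j ∉ S) : NB b (insert j S) (Function.update ω j a) = NB b S ω := by
  rw [← NB_update_notMem b a S ω j hj]
  unfold NB
  rw [Finset.filter_insert, if_neg (by simp [hab.ne])]

theorem deriv_foldr {E : Type*} [DecidableEq E] (a b : ℝ) (hab : a < b) (S1 S2 : Finset E)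
    (hd : Disjoint S1 S2) (G : (E → ℝ) → Prop) (φ : (E → ℝ) → ℝ) (F : ℕ → ℕ → ℝ)
    (hGa : ∀ ω, G ω → ∀ e ∈ S1 ∪ S2, G (Function.update ω e a))
    (hGb : ∀ ω, G ω → ∀ e ∈ S1 ∪ S2, G (Function.update ω e b))
    (hφ : ∀ ω, G ω → φ ω = F (NB b S1 ω) (NB b S2 ω)) (l : List E) :
    l.Nodup → (∀ e ∈ l, e ∈ S1 ∪ S2) → ∀ ω, G ω →
    l.foldr (fun j ψ => envDeriv a b j ψ) φ ω =
      (D1^[(S1 ∩ l.toFinset).card] (D2^[(S2 ∩ l.toFinset).card] F))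
        (NB b (S1 \ l.toFinset) ω) (NB b (S2 \ l.toFinset) ω) := by
  induction l with
  | nil => intro _ _ ω hω; simpa using hφ ω hω
  | cons j l ih =>
    intro hnd hl ω hω
    have hjl : j ∉ l.toFinset := by simpa using (List.nodup_cons.1 hnd).1
    have hjS := hl j (by simp)
    have ih' := ih (List.nodup_cons.1 hnd).2 (fun e he => hl e (List.mem_cons_of_mem _ he))
    simp only [List.foldr_cons, List.toFinset_cons]
    rw [envDeriv, ih' _ (hGb ω hω j hjS), ih' _ (hGa ω hω j hjS)]
    rcases Finset.mem_union.1 hjS with h1 | h2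
    · have h2 : j ∉ S2 := Finset.disjoint_left.1 hd h1
      have e1 : S1 \ l.toFinset = insert j (S1 \ insert j l.toFinset) := by
        ext e; by_cases he : e = j
        · subst he; simp [h1]; simpa using hjl
        · simp [he]
      have e2 : S2 \ insert j l.toFinset = S2 \ l.toFinset := by
        ext e; by_cases he : e = j
        · subst he; simp [h2]
        · simp [he]
      rw [e2, e1, NB_insert_b _ _ _ _ (by simp), NB_insert_a a b hab _ _ _ (by simp),
        NB_update_notMem _ _ _ _ _ (by simp [h2]), NB_update_notMem _ _ _ _ _ (by simp [h2]),
        Finset.inter_insert_of_mem h1, Finset.inter_insert_of_notMem h2,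
        Finset.card_insert_of_notMem (by simp at hjl; simp [hjl]), Function.iterate_succ_apply']
      rfl
    · have h1 : j ∉ S1 := Finset.disjoint_right.1 hd h2
      have e1 : S2 \ l.toFinset = insert j (S2 \ insert j l.toFinset) := by
        ext e; by_cases he : e = j
        · subst he; simp [h2]; simpa using hjl
        · simp [he]
      have e2 : S1 \ insert j l.toFinset = S1 \ l.toFinset := by
        ext e; by_cases he : e = j
        · subst he; simp [h1]
        · simp [he]
      rw [e2, e1, NB_insert_b _ _ _ _ (by simp), NB_insert_a a b hab _ _ _ (by simp),
        NB_update_notMem _ _ _ _ _ (by simp [h1]), NB_update_notMem _ _ _ _ _ (by simp [h1]),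
        Finset.inter_insert_of_mem h2, Finset.inter_insert_of_notMem h1,
        Finset.card_insert_of_notMem (by simp at hjl; simp [hjl]), Function.iterate_succ_apply',
        ← D2_D1_iter]
      rfl

theorem deriv_on {E : Type*} [DecidableEq E] (a b : ℝ) (hab : a < b) (S1 S2 : Finset E)
    (hd : Disjoint S1 S2) (G : (E → ℝ) → Prop) (φ : (E → ℝ) → ℝ) (F : ℕ → ℕ → ℝ)
    (hGa : ∀ ω, G ω → ∀ e ∈ S1 ∪ S2, G (Function.update ω e a))
    (hGb : ∀ ω, G ω → ∀ e ∈ S1 ∪ S2, G (Function.update ω e b))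
    (hφ : ∀ ω, G ω → φ ω = F (NB b S1 ω) (NB b S2 ω)) (ω : E → ℝ) (hω : G ω) :
    envDerivOn a b (S1 ∪ S2) φ ω = (D1^[S1.card] (D2^[S2.card] F)) 0 0 := by
  have := deriv_foldr a b hab S1 S2 hd G φ F hGa hGb hφ (S1 ∪ S2).toList
    (Finset.nodup_toList _) (fun e he => by simpa using he) ω hω
  unfold envDerivOn
  rw [this, Finset.toList_toFinset, Finset.inter_eq_left.2 Finset.subset_union_left,
    Finset.inter_eq_left.2 Finset.subset_union_right,
    Finset.sdiff_eq_empty_iff_subset.2 Finset.subset_union_left,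
    Finset.sdiff_eq_empty_iff_subset.2 Finset.subset_union_right]
  simp [NB]

theorem D1_iter_fwd (r : ℕ) (F : ℕ → ℕ → ℝ) (j : ℕ) :
    (fun i => (D1^[r] F) i j) = (fwdDiff 1)^[r] (fun i => F i j) := by
  induction r with
  | zero => rfl
  | succ r ih =>
    rw [Function.iterate_succ_apply', Function.iterate_succ_apply', ← ih]
    rfl

theorem D1_iter_delta (r c : ℕ) (hc : c ≤ r) (F : ℕ → ℕ → ℝ) (x : ℝ)
    (hF : ∀ i, F i 0 = if i = c then x else 0) :
    (D1^[r] F) 0 0 = (-1) ^ (r - c) * (r.choose c : ℝ) * x := by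
  have h := congrFun (D1_iter_fwd r F 0) 0
  rw [h, fwdDiff_iter_eq_sum_shift, Finset.sum_eq_single c]
  · simp [hF]
  · intro k _ hk; simp [hF, hk]
  · intro h; simp at h; omega

theorem gadget (d : ℕ) (hd : 3 ≤ d) (a b : ℝ) (ha : 0 < a)
    (hab : a < b) (v : Vtx d) (hv : ∀ i, |v i| ≤ 2) (hv0 : v ≠ 0) (p q k : ℕ) :
    ∃ (n : ℕ) (S : Finset (Sym2 (Vtx d))) (ω : Sym2 (Vtx d) → ℝ) (C : ℝ),
       ↑S ⊆ EdgeSet d n ∧ S.card = p + q ∧ ValidEnv d n a b ω ∧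
       envDerivOn a b S (fppT d v n) ω =
         (D1^[p] (D2^[q] (fun i j => C + (b - a) * ((min i (k + j) : ℕ) : ℝ)))) 0 0 := by
  classical
  have hba : 0 < b - a := by linarith
  obtain ⟨i1, hi1⟩ : ∃ i, v i ≠ 0 := by
    by_contra hc; push Not at hc; exact hv0 (funext hc)
  obtain ⟨i2, hi2, i3, hi3, h23⟩ : ∃ i2 ∈ Finset.univ.erase i1, ∃ i3 ∈ Finset.univ.erase i1,
      i2 ≠ i3 := by
    apply Finset.one_lt_card.1
    rw [Finset.card_erase_of_mem (Finset.mem_univ _)]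
    simp; omega
  have h2 : i2 ≠ i1 := Finset.ne_of_mem_erase hi2
  have h3 : i3 ≠ i1 := Finset.ne_of_mem_erase hi3
  set K := k + q with hKdef
  obtain ⟨H0, hH0⟩ := exists_nat_ge (K * (b - a) / (2 * a))
  obtain ⟨H, hHpos, hH⟩ : ∃ H : ℕ, 0 < H ∧ K * (b - a) ≤ 2 * H * a := by
    refine ⟨H0 + 1, by omega, ?_⟩
    rw [div_le_iff₀ (by linarith)] at hH0
    push_cast
    nlinarith
  obtain ⟨M0, hM0⟩ := exists_nat_ge ((2 * H * a + K * (b - a)) / (b - a))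
  obtain ⟨M, hMp, hMK, hM⟩ : ∃ M : ℕ, p ≤ M ∧ K ≤ M ∧
      2 * H * a + K * (b - a) ≤ M * (b - a) := by
    refine ⟨M0 + p + K, by omega, by omega, ?_⟩
    rw [div_le_iff₀ hba] at hM0
    push_cast
    have : 0 ≤ ((p : ℝ) + K) * (b - a) := by positivity
    nlinarith
  obtain ⟨s, hsdef⟩ : ∃ s : Fin d → ℤ, s = fun i => if 0 ≤ v i then 1 else -1 := ⟨_, rfl⟩
  have hs : ∀ i, s i = 1 ∨ s i = -1 := by
    intro i; rw [hsdef]; simp only; split_ifs <;> simp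
  have hsv : ∀ i, s i * v i = |v i| := by
    intro i; rw [hsdef]; simp only; split_ifs with h
    · rw [abs_of_nonneg h]; ring
    · rw [abs_of_neg (by omega)]; ring
  set n := M + H with hn
  set w : Vtx d := fun i => (n : ℤ) * v i with hw
  have habs : ∀ i, |w i| = n * |v i| := by
    intro i; simp only [hw]; rw [abs_mul, abs_of_nonneg (by omega : (0 : ℤ) ≤ n)]
  have hsw : ∀ i, s i * w i = |w i| := by
    intro i; rw [habs, ← hsv]; simp only [hw]; ring
  have hwbox : inBox n w := by
    intro i; rw [habs]; nlinarith [hv i]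
  have hwM : (M : ℤ) ≤ s i1 * w i1 := by
    rw [hsw, habs]
    have : 1 ≤ |v i1| := Int.one_le_abs hi1
    have : (n : ℤ) = M + H := by rw [hn]; push_cast; ring
    nlinarith
  set P := lineE s i1 i2 H with hP
  set Q := lineE s i1 i3 H with hQ
  have hPinj : Function.Injective P := fun t t' h => lineE_inj hs h
  have hQinj : Function.Injective Q := fun t t' h => lineE_inj hs h
  have hPQ : ∀ t t', P t ≠ Q t' := fun t t' => lineE_ne hs hHpos h2 h23
  set S1 := (Finset.range p).image P with hS1
  set S2 := (Finset.Ico k (k + q)).image Q with hS2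
  have mS1 : ∀ t, P t ∈ S1 ↔ t < p := by
    intro t; rw [hS1, Finset.mem_image]
    constructor
    · rintro ⟨t', h, h'⟩; rw [← hPinj h']; simpa using h
    · intro h; exact ⟨t, by simpa using h, rfl⟩
  have mS2 : ∀ t, Q t ∈ S2 ↔ k ≤ t ∧ t < k + q := by
    intro t; rw [hS2, Finset.mem_image]
    constructor
    · rintro ⟨t', h, h'⟩; rw [← hQinj h']; simpa using h
    · intro h; exact ⟨t, by simpa using h, rfl⟩
  have nS1 : ∀ t, Q t ∉ S1 := by
    intro t h
    obtain ⟨t', _, h'⟩ := Finset.mem_image.1 h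
    exact hPQ _ _ h'
  have nS2 : ∀ t, P t ∉ S2 := by
    intro t h
    obtain ⟨t', _, h'⟩ := Finset.mem_image.1 h
    exact hPQ _ _ h'.symm
  have hdisj : Disjoint S1 S2 := by
    rw [Finset.disjoint_left]
    intro e h1 h2
    obtain ⟨t, _, rfl⟩ := Finset.mem_image.1 h1
    exact nS2 _ h2
  have hSline : ∀ e ∈ S1 ∪ S2, (∃ t < M, e = P t) ∨ (∃ t < M, e = Q t) := by
    intro e he
    rcases Finset.mem_union.1 he with h | h
    · obtain ⟨t, ht, rfl⟩ := Finset.mem_image.1 h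
      rw [Finset.mem_range] at ht
      exact Or.inl ⟨t, by omega, rfl⟩
    · obtain ⟨t, ht, rfl⟩ := Finset.mem_image.1 h
      rw [Finset.mem_Ico] at ht
      exact Or.inr ⟨t, by omega, rfl⟩
  set ω0 : Sym2 (Vtx d) → ℝ := fun e => if IsSlab s i1 M e ∧ (∀ t < M, e ≠ P t) ∧
    (∀ t < M, k ≤ t → e ≠ Q t) then b else a with hω0
  set G : (Sym2 (Vtx d) → ℝ) → Prop := fun ω => (∀ e, ω e = a ∨ ω e = b) ∧
    ∀ e, e ∉ S1 ∪ S2 → ω e = ω0 e with hG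
  have hGood : ∀ ω, G ω → GoodEnv a b s i1 i2 i3 M H ω := by
    intro ω hω
    refine ⟨hω.1, ?_, ?_⟩
    · intro e he
      rw [hω.2 e]
      · simp only [hω0]; rw [if_neg (fun h => he h.1)]
      · intro hS
        rcases hSline e hS with ⟨t, ht, rfl⟩ | ⟨t, ht, rfl⟩ <;> exact he (lineE_slab hs ht)
    · intro e he hp hq
      rw [hω.2 e]
      · simp only [hω0]; rw [if_pos ⟨he, hp, fun t ht _ => hq t ht⟩]
      · intro hS
        rcases hSline e hS with ⟨t, ht, rfl⟩ | ⟨t, ht, rfl⟩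
        · exact hp t ht rfl
        · exact hq t ht rfl
  have hGu : ∀ x, (x = a ∨ x = b) → ∀ ω, G ω → ∀ e ∈ S1 ∪ S2, G (Function.update ω e x) := by
    intro x hx ω hω e he
    constructor
    · intro e'
      by_cases h : e' = e
      · subst h; simpa using hx
      · rw [Function.update_of_ne h]; exact hω.1 e'
    · intro e' he'
      have hne : e' ≠ e := fun h => he' (h ▸ he)
      rw [Function.update_of_ne hne]
      exact hω.2 e' he'
  have hG0 : G ω0 := by
    refine ⟨fun e => ?_, fun e _ => rfl⟩
    simp only [hω0]; split_ifs <;> simp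
  have hc2 : ∀ ω, G ω → ((Finset.range M).filter (fun t => ω (P t) = b)).card = NB b S1 ω := by
    intro ω hω
    unfold NB
    rw [hS1, Finset.filter_image, Finset.card_image_of_injective _ hPinj]
    congr 1
    ext t
    simp only [Finset.mem_filter, Finset.mem_range]
    constructor
    · rintro ⟨ht, hb⟩
      refine ⟨?_, hb⟩
      by_contra hpt
      have hn : P t ∉ S1 ∪ S2 := by
        rw [Finset.mem_union, mS1]; rintro (h | h)
        · exact hpt h
        · exact nS2 _ h
      rw [hω.2 _ hn] at hb
      simp only [hω0] at hb
      rw [if_neg (fun h => h.2.1 t ht rfl)] at hb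
      exact hab.ne hb
    · rintro ⟨ht, hb⟩
      exact ⟨by omega, hb⟩
  have hc3 : ∀ ω, G ω → ((Finset.range M).filter (fun t => ω (Q t) = b)).card =
      k + NB b S2 ω := by
    intro ω hω
    unfold NB
    rw [hS2, Finset.filter_image, Finset.card_image_of_injective _ hQinj]
    have : (Finset.range M).filter (fun t => ω (Q t) = b) = Finset.range k ∪
        (Finset.Ico k (k + q)).filter (fun t => ω (Q t) = b) := by
      ext t
      simp only [Finset.mem_filter, Finset.mem_range, Finset.mem_union, Finset.mem_Ico]
      have hnS : ¬ (k ≤ t ∧ t < k + q) → Q t ∉ S1 ∪ S2 := by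
        intro hh
        rw [Finset.mem_union, mS2]; rintro (h | h)
        · exact nS1 _ h
        · exact hh h
      constructor
      · rintro ⟨ht, hb⟩
        by_cases h1 : t < k
        · exact Or.inl h1
        · refine Or.inr ⟨⟨by omega, ?_⟩, hb⟩
          by_contra h2
          rw [hω.2 _ (hnS (by omega))] at hb
          simp only [hω0] at hb
          rw [if_neg (fun h => h.2.2 t ht (by omega) rfl)] at hb
          exact hab.ne hb
      · rintro (h | h)
        · refine ⟨by omega, ?_⟩
          rw [hω.2 _ (hnS (by omega))]
          simp only [hω0]
          rw [if_pos]
          refine ⟨lineE_slab hs (by omega), fun t' _ h => hPQ _ _ h.symm, ?_⟩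
          intro t' _ hk h'
          have := hQinj h'
          omega
        · exact ⟨by omega, h.2⟩
    rw [this, Finset.card_union_of_disjoint, Finset.card_range]
    rw [Finset.disjoint_left]
    intro t ht ht'
    simp at ht ht'
    omega
  have hφ : ∀ ω, G ω → fppT d v n ω = (fun i j : ℕ => ((∑ i, |w i| : ℤ) + 2 * H : ℝ) * a +
      (b - a) * ((min i (k + j) : ℕ) : ℝ)) (NB b S1 ω) (NB b S2 ω) := by
    intro ω hω
    refine fpp_value (K := K) ha hab (hGood ω hω) hs h2 h3 h23 (by omega) (by omega) v w rfl hwbox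
      hwM hsw hH hM _ _ (hc2 ω hω) (hc3 ω hω) ?_
    refine (min_le_right _ _).trans ?_
    have : NB b S2 ω ≤ q := by
      unfold NB
      refine (Finset.card_filter_le _ _).trans (Finset.card_image_le.trans ?_)
      simp
    omega
  have card1 : S1.card = p := by
    rw [hS1, Finset.card_image_of_injective _ hPinj, Finset.card_range]
  have card2 : S2.card = q := by
    rw [hS2, Finset.card_image_of_injective _ hQinj, Nat.card_Ico]; omega
  refine ⟨n, S1 ∪ S2, ω0, ((∑ i, |w i| : ℤ) + 2 * H : ℝ) * a, ?_, ?_, fun e _ => hG0.1 e, ?_⟩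
  · intro e he
    rcases hSline e (by exact_mod_cast he) with ⟨t, ht, rfl⟩ | ⟨t, ht, rfl⟩ <;>
      exact lineE_edge hs (by omega) (by omega)
  · rw [Finset.card_union_of_disjoint hdisj, card1, card2]
  · have := deriv_on a b hab S1 S2 hdisj G (fppT d v n) (fun i j : ℕ =>
      ((∑ i, |w i| : ℤ) + 2 * H : ℝ) * a + (b - a) * ((min i (k + j) : ℕ) : ℝ)) (hGu a (Or.inl rfl)) (hGu b (Or.inr rfl))
      hφ ω0 hG0
    rw [card1, card2] at this
    convert this using 1

/--
In dimensions `d ≥ 3`, for every integer `m ≥ 2` the extremal values of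
the `m`-th order environment derivatives satisfy `U_m ≥ C(m−2, ⌈(m−2)/2⌉)` and
`L_m ≤ −C(m−2, ⌈(m−2)/2⌉)`: there exist `n`, `S ⊆ W_n` with `|S| = m`, and `ω ∈ Ω_n` with
`∂_S f_n(ω) ≥ (b−a)·C(m−2, ⌈(m−2)/2⌉)`, and there exist `n'`, `S' ⊆ W_{n'}` with
`|S'| = m`, and `ω' ∈ Ω_{n'}` with `∂_{S'} f_{n'}(ω') ≤ −(b−a)·C(m−2, ⌈(m−2)/2⌉)`.
(Here `⌈(m−2)/2⌉ = ((m−2)+1)/2` in natural-number division.)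
-/
theorem extremal_deriv_binomial_bounds (d : ℕ) (hd : 3 ≤ d) (a b : ℝ) (ha : 0 < a)
    (hab : a < b) (v : Vtx d) (hv : ∀ i, |v i| ≤ 2) (hv0 : v ≠ 0)
    (m : ℕ) (hm : 2 ≤ m) :
    (∃ (n : ℕ) (S : Finset (Sym2 (Vtx d))) (ω : Sym2 (Vtx d) → ℝ),
       ↑S ⊆ EdgeSet d n ∧ S.card = m ∧ ValidEnv d n a b ω ∧
       envDerivOn a b S (fppT d v n) ω ≥
         (b - a) * ((m - 2).choose (((m - 2) + 1) / 2) : ℝ)) ∧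
    (∃ (n' : ℕ) (S' : Finset (Sym2 (Vtx d))) (ω' : Sym2 (Vtx d) → ℝ),
       ↑S' ⊆ EdgeSet d n' ∧ S'.card = m ∧ ValidEnv d n' a b ω' ∧
       envDerivOn a b S' (fppT d v n') ω' ≤
         -((b - a) * ((m - 2).choose (((m - 2) + 1) / 2) : ℝ))) := by
  obtain ⟨r, rfl⟩ : ∃ r, m = r + 2 := ⟨m - 2, by omega⟩
  simp only [Nat.add_sub_cancel]
  set c := (r + 1) / 2 with hc
  have hcr : c ≤ r := by omega
  obtain ⟨n1, S1, ω1, C1, hS1, hc1, hv1, hd1⟩ := gadget d hd a b ha hab v hv hv0 (r + 2) 0 (c + 1)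
  obtain ⟨n2, S2, ω2, C2, hS2, hc2, hv2, hd2⟩ := gadget d hd a b ha hab v hv hv0 (r + 1) 1 c
  have e1 : envDerivOn a b S1 (fppT d v n1) ω1 =
      (-1) ^ (r - c) * (r.choose c : ℝ) * (-(b - a)) := by
    rw [hd1, Function.iterate_add_apply]
    apply D1_iter_delta r c hcr
    intro i
    simp only [Function.iterate_succ_apply', Function.iterate_zero_apply, D1, Nat.add_zero]
    split_ifs with h
    · subst h
      rw [min_eq_right (by omega), min_eq_left (by omega), min_eq_left (by omega)]
      push_cast; ring
    · rcases lt_or_gt_of_ne h with h | h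
      · rw [min_eq_left (by omega), min_eq_left (by omega), min_eq_left (by omega)]
        push_cast; ring
      · rw [min_eq_right (by omega), min_eq_right (by omega), min_eq_right (by omega)]
        ring
  have e2 : envDerivOn a b S2 (fppT d v n2) ω2 =
      (-1) ^ (r - c) * (r.choose c : ℝ) * (b - a) := by
    rw [hd2, Function.iterate_add_apply]
    apply D1_iter_delta r c hcr
    intro i
    simp only [Function.iterate_one, D1, D2, Nat.add_zero, Nat.zero_add]
    split_ifs with h
    · subst h
      rw [min_eq_left (by omega), min_eq_right (by omega), min_eq_left (by omega),
        min_eq_left (by omega)]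
      push_cast; ring
    · rcases lt_or_gt_of_ne h with h | h
      · rw [min_eq_left (by omega), min_eq_left (by omega), min_eq_left (by omega),
          min_eq_left (by omega)]
        ring
      · rw [min_eq_right (by omega), min_eq_right (by omega), min_eq_right (by omega),
          min_eq_right (by omega)]
        ring
  rcases neg_one_pow_eq_or ℝ (r - c) with h | h
  · rw [h] at e1 e2
    exact ⟨⟨n2, S2, ω2, hS2, hc2, hv2, by rw [e2]; exact le_of_eq (by ring)⟩,
      ⟨n1, S1, ω1, hS1, hc1, hv1, by rw [e1]; exact le_of_eq (by ring)⟩⟩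
  · rw [h] at e1 e2
    exact ⟨⟨n1, S1, ω1, hS1, hc1, hv1, by rw [e1]; exact le_of_eq (by ring)⟩,
      ⟨n2, S2, ω2, hS2, hc2, hv2, by rw [e2]; exact le_of_eq (by ring)⟩⟩

end
end
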